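/- arXiv:0811.3057 — 4 statements merged into one kernel-verified Lean document; each statement's English description precedes it below -/
import Mathlib

section
/- Let k ≥ 3 be an integer and set n = ⌈log k⌉ (log denoting the base-2 logarithm). There exists a positive constant C such that for every integer N ≥ 1, r_k(N)/N ≥ C · (log N)^{1/(2n)} / 2^{n · 2^{(n−1)/2} · (log N)^{1/n}}. -/
/-- `A` contains a `k`-term `D`-progression: there is a nonconstant real polynomial `Q`
of degree at most `D` such that `Q 1, Q 2, …, Q k` all lie in `A`. -/
def HasProgression (A : Finset ℕ) (k D : ℕ) : Prop :=
  ∃ Q : Polynomial ℝ, 0 < Q.natDegree ∧ Q.natDegree ≤ D ∧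
    ∀ j ∈ Finset.Icc 1 k, ∃ m ∈ A, (m : ℝ) = Q.eval (j : ℝ)

/-- `rkD k D N` is the maximum size of a subset of `[1,N] ∩ ℤ` containing no
`k`-term `D`-progression. -/
noncomputable def rkD (k D N : ℕ) : ℕ :=
  sSup {m | ∃ A : Finset ℕ, A ⊆ Finset.Icc 1 N ∧ ¬ HasProgression A k D ∧ A.card = m}

/-- Iterated forward differences of a sequence. -/
def dd {R : Type*} [Ring R] : ℕ → (ℕ → R) → ℕ → R
  | 0, f => f
  | m + 1, f => dd m (fun j => f (j + 1) - f j)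

lemma dd_succ' {R : Type*} [Ring R] (m : ℕ) : ∀ (f : ℕ → R) (j : ℕ),
    dd (m + 1) f j = dd m f (j + 1) - dd m f j := by
  induction m with
  | zero => intro f j; rfl
  | succ m ih =>
    intro f j
    show dd (m + 1) (fun j => f (j + 1) - f j) j = _
    rw [ih]
    rfl

lemma dd_congr {R : Type*} [Ring R] (m : ℕ) : ∀ (f g : ℕ → R) (j : ℕ),
    (∀ i, j ≤ i → i ≤ j + m → f i = g i) → dd m f j = dd m g j := by
  induction m with
  | zero => intro f g j h; exact h j le_rfl le_rfl
  | succ m ih =>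
    intro f g j h
    rw [dd_succ', dd_succ', ih f g j (fun i h1 h2 => h i h1 (by omega)),
      ih f g (j + 1) (fun i h1 h2 => h i (by omega) (by omega))]

lemma dd_map {R S : Type*} [Ring R] [Ring S] (φ : R →+* S) (m : ℕ) (f : ℕ → R) : ∀ (j : ℕ),
    dd m (fun i => φ (f i)) j = φ (dd m f j) := by
  induction m with
  | zero => intro j; rfl
  | succ m ih => intro j; rw [dd_succ', dd_succ', ih, ih, map_sub]

lemma dd_add {R : Type*} [Ring R] (m : ℕ) (f g : ℕ → R) : ∀ (j : ℕ),
    dd m (fun i => f i + g i) j = dd m f j + dd m g j := by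
  induction m with
  | zero => intro j; rfl
  | succ m ih => intro j; rw [dd_succ', dd_succ', dd_succ', ih, ih]; abel

lemma dd_mul {R : Type*} [Ring R] (w : R) (m : ℕ) (f : ℕ → R) : ∀ (j : ℕ),
    dd m (fun i => w * f i) j = w * dd m f j := by
  induction m with
  | zero => intro j; rfl
  | succ m ih => intro j; rw [dd_succ', dd_succ', ih, ih, mul_sub]

lemma dd_const {R : Type*} [Ring R] (c : R) (m : ℕ) : ∀ (j : ℕ),
    dd (m + 1) (fun _ => c) j = 0 := by
  induction m with
  | zero => intro j; simp [dd]
  | succ m ih => intro j; rw [dd_succ', ih, ih, sub_zero]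

lemma dd_abs (m : ℕ) : ∀ (f : ℕ → ℤ) (B : ℤ) (j : ℕ),
    (∀ i, j ≤ i → i ≤ j + m → |f i| ≤ B) → |dd m f j| ≤ 2 ^ m * B := by
  induction m with
  | zero => intro f B j h; simpa [dd] using h j le_rfl le_rfl
  | succ m ih =>
    intro f B j h
    rw [dd_succ']
    have h1 := ih f B j (fun i h1 h2 => h i h1 (by omega))
    have h2 := ih f B (j + 1) (fun i h1 h2 => h i (by omega) (by omega))
    have h3 := abs_sub (dd m f (j + 1)) (dd m f j)
    rw [pow_succ]
    linarith

lemma dd_abs' (m : ℕ) (f : ℕ → ℤ) (W : ℤ) (j : ℕ)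
    (h : ∀ i, j ≤ i → i ≤ j + (m + 1) → 0 ≤ f i ∧ f i ≤ W) : |dd (m + 1) f j| ≤ 2 ^ m * W := by
  show |dd m (fun j => f (j + 1) - f j) j| ≤ _
  apply dd_abs
  intro i h1 h2
  have := h i h1 (by omega)
  have := h (i + 1) (by omega) (by omega)
  rw [abs_le]
  constructor <;> linarith

lemma dd_eq_fwdDiff (P : Polynomial ℝ) (m : ℕ) : ∀ j : ℕ,
    dd m (fun i : ℕ => P.eval (i : ℝ)) j = ((fwdDiff (1 : ℝ))^[m] P.eval) (j : ℝ) := by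
  induction m with
  | zero => intro j; rfl
  | succ m ih =>
    intro j
    rw [dd_succ', ih, ih, Function.iterate_succ_apply', fwdDiff]
    push_cast
    rfl

lemma dd_poly_zero (P : Polynomial ℝ) (m : ℕ) (h : P.natDegree < m) (j : ℕ) :
    dd m (fun i : ℕ => P.eval (i : ℝ)) j = 0 := by
  rw [dd_eq_fwdDiff, Polynomial.fwdDiff_iter_eq_zero_of_degree_lt h]
  rfl

lemma dd_poly_top (P : Polynomial ℝ) (m : ℕ) (h : P.natDegree ≤ m) (j : ℕ) :
    dd m (fun i : ℕ => P.eval (i : ℝ)) j = (m.factorial : ℝ) * P.coeff m := by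
  rcases h.lt_or_eq with h | h
  · rw [dd_poly_zero P m h, Polynomial.coeff_eq_zero_of_natDegree_lt h, mul_zero]
  · subst h
    rw [dd_eq_fwdDiff, Polynomial.fwdDiff_iter_degree_eq_factorial]
    simp [mul_comm]

lemma dd_unique (m : ℕ) : ∀ (g : ℕ → ℝ) (k : ℕ), (∀ j, 1 ≤ j → j ≤ m → j ≤ k → g j = 0) →
    (∀ j, 1 ≤ j → j + m ≤ k → dd m g j = 0) → ∀ j, 1 ≤ j → j ≤ k → g j = 0 := by
  induction m with
  | zero => intro g k _ h2 j h3 h4; exact h2 j h3 h4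
  | succ m ih =>
    intro g k h1 h2
    have h := ih (fun j => g (j + 1) - g j) (k - 1) (by
      intro j a b c
      show g (j + 1) - g j = 0
      rw [h1 (j + 1) (by omega) (by omega) (by omega), h1 j (by omega) (by omega) (by omega),
        sub_zero]) (by
      intro j a b
      exact h2 j a (by omega))
    intro j
    induction j with
    | zero => intro h; omega
    | succ j ihj =>
      intro a b
      rcases Nat.eq_zero_or_pos j with rfl | hj
      · exact h1 1 le_rfl (by omega) b
      · have e1 := h j hj (by omega)
        have e2 := ihj hj (by omega)
        linarith

lemma interp (f : ℕ → ℤ) (k m : ℕ)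
    (h : ∀ j, 1 ≤ j → j + (m + 1) ≤ k → dd (m + 1) f j = 0) :
    ∃ Q : Polynomial ℝ, Q.natDegree ≤ m ∧ ∀ j : ℕ, 1 ≤ j → j ≤ k → ((f j : ℤ) : ℝ) = Q.eval (j : ℝ) := by
  have hinj : Set.InjOn (fun i : ℕ => (i : ℝ)) (Finset.Icc 1 (m + 1) : Finset ℕ) := by
    intro a _ b _ hab
    exact Nat.cast_injective (R := ℝ) hab
  set Q := Lagrange.interpolate (Finset.Icc 1 (m + 1)) (fun i : ℕ => (i : ℝ))
    (fun i => ((f i : ℤ) : ℝ)) with hQ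
  have hdeg : Q.natDegree < m + 1 := by
    have := Lagrange.degree_interpolate_lt (r := fun i => ((f i : ℤ) : ℝ)) hinj
    rw [Nat.card_Icc] at this
    rw [← hQ] at this
    rcases eq_or_ne Q 0 with h0 | h0
    · simp [h0]
    · exact (Polynomial.natDegree_lt_iff_degree_lt h0).2 (by simpa using this)
  have key := dd_unique (m + 1) (fun j => ((f j : ℤ) : ℝ) + (-1) * Q.eval (j : ℝ)) k (by
    intro j a b c
    have : Q.eval ((fun i : ℕ => (i : ℝ)) j) = ((f j : ℤ) : ℝ) :=
      Lagrange.eval_interpolate_at_node _ hinj (Finset.mem_Icc.2 ⟨a, b⟩)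
    simp only at this
    simp [this]) (by
    intro j a b
    rw [dd_add, dd_mul, dd_poly_zero Q _ hdeg]
    have := dd_map (Int.castRingHom ℝ) (m + 1) f j
    simp only [Int.coe_castRingHom] at this
    rw [this, h j a b]
    simp)
  refine ⟨Q, by omega, ?_⟩
  intro j a b
  have := key j a b
  linarith

lemma sq_diff {d : ℕ} (x : Fin d → ℕ → ℤ) (k e : ℕ) (hk : 2 * e + 1 ≤ k)
    (h : ∀ i j, 1 ≤ j → j + (e + 1) ≤ k → dd (e + 1) (x i) j = 0) :
    (∀ m, 2 * e < m → ∀ j, 1 ≤ j → j + m ≤ k → dd m (fun j => ∑ i, x i j ^ 2) j = 0) ∧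
    ∑ i, (dd e (x i) 1) ^ 2 ≤ dd (2 * e) (fun j => ∑ i, x i j ^ 2) 1 := by
  choose P hP1 hP2 using fun i => interp (x i) k e (h i)
  set S : Polynomial ℝ := ∑ i, P i ^ 2 with hS
  have hdeg : S.natDegree ≤ 2 * e := by
    apply Polynomial.natDegree_sum_le_of_forall_le
    intro i _
    refine (Polynomial.natDegree_pow_le).trans ?_
    exact Nat.mul_le_mul_left 2 (hP1 i)
  have hSe : ∀ j : ℕ, 1 ≤ j → j ≤ k → ((∑ i, x i j ^ 2 : ℤ) : ℝ) = S.eval (j : ℝ) := by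
    intro j a b
    rw [hS, Polynomial.eval_finsetSum]
    push_cast
    refine Finset.sum_congr rfl (fun i _ => ?_)
    rw [hP2 i j a b, Polynomial.eval_pow]
  have hcast : ∀ m j, 1 ≤ j → j + m ≤ k → ((dd m (fun j => ∑ i, x i j ^ 2) j : ℤ) : ℝ) =
      dd m (fun i : ℕ => S.eval (i : ℝ)) j := by
    intro m j a b
    have := dd_map (Int.castRingHom ℝ) m (fun j => ∑ i, x i j ^ 2) j
    simp only [Int.coe_castRingHom] at this
    rw [← this]
    apply dd_congr
    intro i h1 h2
    exact hSe i (by omega) (by omega)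
  constructor
  · intro m hm j a b
    have := hcast m j a b
    rw [dd_poly_zero S m (by omega)] at this
    exact_mod_cast this
  · have h1 := hcast (2 * e) 1 le_rfl (by omega)
    rw [dd_poly_top S _ hdeg] at h1
    have h2 : ∀ i, ((dd e (x i) 1 : ℤ) : ℝ) = (e.factorial : ℝ) * (P i).coeff e := by
      intro i
      rw [← dd_poly_top (P i) e (hP1 i) 1]
      have := dd_map (Int.castRingHom ℝ) e (x i) 1
      simp only [Int.coe_castRingHom] at this
      rw [← this]
      apply dd_congr
      intro j h1 h2
      exact hP2 i j (by omega) (by omega)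
    have h3 : S.coeff (2 * e) = ∑ i, (P i).coeff e ^ 2 := by
      rw [hS, Polynomial.finsetSum_coeff]
      exact Finset.sum_congr rfl (fun i _ => Polynomial.coeff_pow_of_natDegree_le (hP1 i))
    have h4 : ((∑ i, (dd e (x i) 1) ^ 2 : ℤ) : ℝ) ≤
        ((dd (2 * e) (fun j => ∑ i, x i j ^ 2) 1 : ℤ) : ℝ) := by
      rw [h1, h3]
      push_cast
      simp only [h2, mul_pow]
      rw [← Finset.mul_sum]
      apply mul_le_mul_of_nonneg_right _ (Finset.sum_nonneg fun i _ => sq_nonneg _)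
      have := Nat.le_of_dvd (Nat.factorial_pos (e + e)) (Nat.factorial_mul_factorial_dvd_factorial_add e e)
      rw [sq, two_mul]
      exact_mod_cast this
    exact_mod_cast h4

lemma no_prog (k D N d M Lb δ : ℕ) (hk : 2 * D + 1 ≤ k)
    (hLb : (2 : ℤ) ^ D * ((Lb : ℤ) - 1) < M) (hδ : 0 < δ)
    (A' : Finset ℕ) (hA' : ¬ HasProgression A' k (2 * D))
    (ω α : Fin d → ZMod M)
    (hω : ∀ c : ℕ, 1 ≤ c → c ≤ 2 ^ D * N → ∀ y : Fin d → ℤ,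
      (∀ i, ((y i : ℤ) : ZMod M) = ω i * (c : ZMod M)) → ((4 ^ D * δ : ℕ) : ℤ) < ∑ i, y i ^ 2)
    (z : ℤ) (A : Finset ℕ) (hA : A ⊆ Finset.Icc 1 N)
    (hAS : ∀ a ∈ A, ∃ x : Fin d → ℕ, (∀ i, x i < Lb) ∧
      (∀ i, ((x i : ℕ) : ZMod M) = ω i * (a : ZMod M) + α i) ∧
      ∃ a' ∈ A', ∃ r, r < δ ∧ ((∑ i, x i ^ 2 : ℕ) : ℤ) = z + a' * ((4 ^ D * δ : ℕ) : ℤ) + r) :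
    ¬ HasProgression A k D := by
  rintro ⟨Q, h0, hD, hQ⟩
  set T : ℤ := ((4 ^ D * δ : ℕ) : ℤ) with hT
  have hTpos : 0 < T := by rw [hT]; positivity
  have hex : ∀ j : ℕ, ∃ (m : ℕ) (x : Fin d → ℕ) (a' r : ℕ), 1 ≤ j → j ≤ k →
      (m ∈ A ∧ (m : ℝ) = Q.eval (j : ℝ) ∧ (∀ i, x i < Lb) ∧
      (∀ i, ((x i : ℕ) : ZMod M) = ω i * (m : ZMod M) + α i) ∧ a' ∈ A' ∧ r < δ ∧
      ((∑ i, x i ^ 2 : ℕ) : ℤ) = z + a' * T + r) := by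
    intro j
    by_cases hj : 1 ≤ j ∧ j ≤ k
    · obtain ⟨m, hm, hm2⟩ := hQ j (Finset.mem_Icc.2 hj)
      obtain ⟨x, hx1, hx2, a', ha', r, hr, hx3⟩ := hAS m hm
      exact ⟨m, x, a', r, fun _ _ => ⟨hm, hm2, hx1, hx2, ha', hr, hx3⟩⟩
    · exact ⟨0, fun _ => 0, 0, 0, fun h1 h2 => absurd ⟨h1, h2⟩ hj⟩
  choose m x a' r hall using hex
  set e := Q.natDegree with he
  set a : ℕ → ℤ := fun j => (m j : ℤ) with ha
  have hcast : ∀ n j, 1 ≤ j → j + n ≤ k → ((dd n a j : ℤ) : ℝ) =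
      dd n (fun i : ℕ => Q.eval (i : ℝ)) j := by
    intro n j h1 h2
    have := dd_map (Int.castRingHom ℝ) n a j
    simp only [Int.coe_castRingHom] at this
    rw [← this]
    apply dd_congr
    intro i h3 h4
    rw [← (hall i (by omega) (by omega)).2.1]
    simp [ha]
  have hda : ∀ j, 1 ≤ j → j + (e + 1) ≤ k → dd (e + 1) a j = 0 := by
    intro j h1 h2
    have := hcast (e + 1) j h1 h2
    rw [dd_poly_zero Q _ (by omega)] at this
    exact_mod_cast this
  have hc0 : dd e a 1 ≠ 0 := by
    intro hc
    have := hcast e 1 le_rfl (by omega)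
    rw [dd_poly_top Q _ le_rfl, hc] at this
    have h1 : Q.coeff e ≠ 0 := by
      have : Q ≠ 0 := by rintro rfl; simp [he] at h0
      rw [he, Polynomial.coeff_natDegree]
      exact Polynomial.leadingCoeff_ne_zero.2 this
    have h2 : (e.factorial : ℝ) ≠ 0 := by positivity
    apply mul_ne_zero h2 h1
    rw [← this]; simp
  have hcN : |dd e a 1| ≤ 2 ^ D * N := by
    have h1 : |dd e a 1| ≤ 2 ^ e * N := by
      apply dd_abs
      intro i h1 h2
      have := Finset.mem_Icc.1 (hA (hall i (by omega) (by omega)).1)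
      simp only [ha]
      rw [abs_of_nonneg (by positivity)]
      exact_mod_cast this.2
    refine h1.trans ?_
    gcongr
    norm_num
  set X : Fin d → ℕ → ℤ := fun i j => (x j i : ℤ) with hX
  have hXmod : ∀ n, 0 < n → ∀ i j, 1 ≤ j → j + n ≤ k →
      ((dd n (X i) j : ℤ) : ZMod M) = ω i * ((dd n a j : ℤ) : ZMod M) := by
    intro n hn i j h1 h2
    have e1 := dd_map (Int.castRingHom (ZMod M)) n (X i) j
    have e2 := dd_map (Int.castRingHom (ZMod M)) n a j
    simp only [Int.coe_castRingHom] at e1 e2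
    rw [← e1, ← e2, ← dd_mul]
    obtain ⟨n, rfl⟩ : ∃ n', n = n' + 1 := ⟨n - 1, by omega⟩
    have e3 := dd_add (n + 1) (fun j => ω i * ((a j : ℤ) : ZMod M)) (fun _ => α i) j
    rw [dd_const, add_zero] at e3
    rw [← e3]
    apply dd_congr
    intro l h3 h4
    have := (hall l (by omega) (by omega)).2.2.2.1 i
    simpa [hX, ha] using this
  have hXz : ∀ i j, 1 ≤ j → j + (e + 1) ≤ k → dd (e + 1) (X i) j = 0 := by
    intro i j h1 h2
    apply Int.eq_zero_of_abs_lt_dvd (m := (M : ℤ))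
    · rw [← ZMod.intCast_zmod_eq_zero_iff_dvd, hXmod (e + 1) (by omega) i j h1 h2, hda j h1 h2]
      simp
    · have hb : |dd (e + 1) (X i) j| ≤ 2 ^ e * ((Lb : ℤ) - 1) := by
        apply dd_abs'
        intro l h3 h4
        have := (hall l (by omega) (by omega)).2.2.1 i
        simp only [hX]
        omega
      have hL : (0 : ℤ) ≤ (Lb : ℤ) - 1 := by
        have := (hall j (by omega) (by omega)).2.2.1 i
        omega
      refine (hb.trans ?_).trans_lt hLb
      gcongr
      norm_num
  obtain ⟨hs1, hs2⟩ := sq_diff X k e (by omega) hXz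
  have hF : ∀ j, 1 ≤ j → j ≤ k → ∑ i, X i j ^ 2 = (r j : ℤ) + (T * (a' j : ℤ) + z) := by
    intro j h1 h2
    have := (hall j h1 h2).2.2.2.2.2.2
    push_cast at this
    simp only [hX]
    rw [this]
    ring
  have hFd : ∀ n, 0 < n → ∀ j, 1 ≤ j → j + n ≤ k → dd n (fun j => ∑ i, X i j ^ 2) j =
      dd n (fun j => (r j : ℤ)) j + T * dd n (fun j => (a' j : ℤ)) j := by
    intro n hn j h1 h2
    rw [← dd_mul]
    obtain ⟨n, rfl⟩ : ∃ n', n = n' + 1 := ⟨n - 1, by omega⟩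
    have e3 := dd_add (n + 1) (fun j => T * (a' j : ℤ)) (fun _ => z) j
    rw [dd_const, add_zero] at e3
    rw [← e3, ← dd_add]
    apply dd_congr
    intro l h3 h4
    exact hF l (by omega) (by omega)
  have hr : ∀ n j, 1 ≤ j → j + (n + 1) ≤ k →
      |dd (n + 1) (fun j => (r j : ℤ)) j| ≤ 2 ^ n * ((δ : ℤ) - 1) := by
    intro n j h1 h2
    apply dd_abs'
    intro l h3 h4
    have := (hall l (by omega) (by omega)).2.2.2.2.2.1
    omega
  have hTD : T = 2 ^ (2 * D) * (δ : ℤ) := by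
    rw [hT, pow_mul]; push_cast; norm_num
  have ha'd : ∀ j, 1 ≤ j → j + (2 * D + 1) ≤ k →
      dd (2 * D + 1) (fun j => (a' j : ℤ)) j = 0 := by
    intro j h1 h2
    have e1 := hFd (2 * D + 1) (by omega) j h1 h2
    rw [hs1 (2 * D + 1) (by omega) j h1 h2] at e1
    have e2 := hr (2 * D) j h1 h2
    have e3 : dd (2 * D + 1) (fun j => (r j : ℤ)) j = 0 := by
      apply Int.eq_zero_of_abs_lt_dvd (m := T)
      · exact ⟨- dd (2 * D + 1) (fun j => (a' j : ℤ)) j, by linarith⟩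
      · refine e2.trans_lt ?_
        rw [hTD]
        have : (0 : ℤ) < 2 ^ (2 * D) := by positivity
        nlinarith
    rw [e3, zero_add] at e1
    rcases mul_eq_zero.1 e1.symm with h | h
    · omega
    · exact h
  obtain ⟨Q', hQ'1, hQ'2⟩ := interp (fun j => (a' j : ℤ)) k (2 * D) ha'd
  have hQ'0 : Q'.natDegree = 0 := by
    by_contra hne
    apply hA'
    refine ⟨Q', by omega, hQ'1, ?_⟩
    intro j hj
    rw [Finset.mem_Icc] at hj
    refine ⟨a' j, (hall j hj.1 hj.2).2.2.2.2.1, ?_⟩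
    have := hQ'2 j hj.1 hj.2
    simpa using this
  have ha'c : ∀ j, 1 ≤ j → j ≤ k → (a' j : ℤ) = a' 1 := by
    intro j h1 h2
    have e1 := hQ'2 j h1 h2
    have e2 := hQ'2 1 le_rfl (by omega)
    rw [Polynomial.eq_C_of_natDegree_eq_zero hQ'0, Polynomial.eval_C] at e1 e2
    have := e1.trans e2.symm
    exact_mod_cast this
  have hlast : ∑ i, (dd e (X i) 1) ^ 2 ≤ T := by
    refine hs2.trans ?_
    rw [hFd (2 * e) (by omega) 1 le_rfl (by omega)]
    have e1 : dd (2 * e) (fun j => (a' j : ℤ)) 1 = dd (2 * e) (fun _ => (a' 1 : ℤ)) 1 := by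
      apply dd_congr
      intro i h1 h2
      exact ha'c i h1 (by omega)
    obtain ⟨n, hn⟩ : ∃ n', 2 * e = n' + 1 := ⟨2 * e - 1, by omega⟩
    rw [e1, hn, dd_const, mul_zero, add_zero]
    refine (le_abs_self _).trans ((hr n 1 le_rfl (by omega)).trans ?_)
    rw [hTD]
    have h5 : (2 : ℤ) ^ n ≤ 2 ^ (2 * D) := by
      gcongr
      · norm_num
      · omega
    have h6 : (0 : ℤ) < 2 ^ n := by positivity
    have h7 : (1 : ℤ) ≤ δ := by exact_mod_cast hδ
    nlinarith
  have hcn : 1 ≤ (dd e a 1).natAbs := Int.natAbs_pos.2 hc0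
  have hcn2 : (dd e a 1).natAbs ≤ 2 ^ D * N := by
    zify
    exact hcN
  rcases le_total 0 (dd e a 1) with hs | hs
  · have := hω _ hcn hcn2 (fun i => dd e (X i) 1) (by
      intro i
      rw [hXmod e h0 i 1 le_rfl (by omega)]
      congr 1
      rw [← Int.cast_natCast, Int.natCast_natAbs, abs_of_nonneg hs])
    omega
  · have := hω _ hcn hcn2 (fun i => - dd e (X i) 1) (by
      intro i
      rw [Int.cast_neg, hXmod e h0 i 1 le_rfl (by omega)]
      rw [← Int.cast_natCast, Int.natCast_natAbs, abs_of_nonpos hs]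
      push_cast
      ring)
    simp only [neg_sq] at this
    omega

lemma sum_frac_aux (s : ℕ) (hs : 1 ≤ s) (B : ℕ) :
    ∑ t ∈ Finset.range B, (s : ℝ) ^ 2 / ((s : ℝ) ^ 2 + ((t : ℝ) + 1) ^ 2) ≤
      (2 * (s : ℝ) * (B : ℝ)) / ((B : ℝ) + (s : ℝ)) := by
  have hs' : (1 : ℝ) ≤ s := by exact_mod_cast hs
  induction B with
  | zero => simp
  | succ B ih =>
    rw [Finset.sum_range_succ]
    have hB : (0 : ℝ) ≤ B := by positivity
    have key : (s : ℝ) ^ 2 / ((s : ℝ) ^ 2 + ((B : ℝ) + 1) ^ 2) ≤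
        2 * s * (B + 1) / (B + 1 + s) - 2 * s * B / (B + s) := by
      rw [div_sub_div _ _ (by positivity) (by positivity), div_le_div_iff₀ (by positivity) (by positivity)]
      have : 2 * (s : ℝ) * (B + 1) * (B + s) - (B + 1 + s) * (2 * s * B) = 2 * s ^ 2 := by ring
      rw [this]
      have h2 : ((B : ℝ) + 1 + s) * (B + s) ≤ 2 * (s ^ 2 + (B + 1) ^ 2) := by
        nlinarith [sq_nonneg ((s : ℝ) - (B + 1))]
      nlinarith [mul_le_mul_of_nonneg_left h2 (sq_nonneg (s : ℝ))]
    push_cast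
    linarith

lemma sum_Icc_symm (f : ℤ → ℝ) (hf : ∀ t, f (-t) = f t) (B : ℕ) :
    ∑ t ∈ Finset.Icc (-(B : ℤ)) B, f t = f 0 + 2 * ∑ t ∈ Finset.range B, f ((t : ℤ) + 1) := by
  induction B with
  | zero => simp
  | succ B ih =>
    have : Finset.Icc (-((B + 1 : ℕ) : ℤ)) ((B + 1 : ℕ) : ℤ) =
        insert (-((B : ℤ) + 1)) (insert ((B : ℤ) + 1) (Finset.Icc (-(B : ℤ)) B)) := by
      ext t
      simp only [Finset.mem_Icc, Finset.mem_insert]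
      push_cast
      omega
    rw [this, Finset.sum_insert, Finset.sum_insert, ih, Finset.sum_range_succ, hf]
    · ring
    · simp
    · simp only [Finset.mem_Icc, Finset.mem_insert]
      omega

lemma ball_card (d s B : ℕ) (hs : 1 ≤ s) :
    ((Fintype.piFinset fun _ : Fin d => Finset.Icc (-(B : ℤ)) B).filter
      (fun y => ∑ i, y i ^ 2 ≤ ((d * s ^ 2 : ℕ) : ℤ))).card ≤ (15 * s) ^ d := by
  have hs' : (1 : ℝ) ≤ s := by exact_mod_cast hs
  set w : ℤ → ℝ := fun t => (s : ℝ) ^ 2 / ((s : ℝ) ^ 2 + (t : ℝ) ^ 2) with hw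
  have hw0 : ∀ t, 0 ≤ w t := fun t => by simp only [hw]; positivity
  have hsum : ∑ t ∈ Finset.Icc (-(B : ℤ)) B, w t ≤ 5 * s := by
    rw [sum_Icc_symm w (by intro t; simp [hw])]
    have h1 := sum_frac_aux s hs B
    have h2 : 2 * (s : ℝ) * B / (B + s) ≤ 2 * s := by
      rw [div_le_iff₀ (by positivity)]
      nlinarith
    have h3 : w 0 = 1 := by
      simp only [hw]; simp; omega
    have h4 : ∑ t ∈ Finset.range B, w ((t : ℤ) + 1) =
      ∑ t ∈ Finset.range B, (s : ℝ) ^ 2 / ((s : ℝ) ^ 2 + ((t : ℝ) + 1) ^ 2) := by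
      refine Finset.sum_congr rfl fun t _ => ?_
      simp [hw]
    rw [h3, h4]
    linarith
  have hpt : ∀ y : Fin d → ℤ, ∑ i, y i ^ 2 ≤ ((d * s ^ 2 : ℕ) : ℤ) →
      (1 : ℝ) ≤ 3 ^ d * ∏ i, w (y i) := by
    intro y hy
    have h1 : ∏ i, (w (y i))⁻¹ ≤ Real.exp d := by
      calc ∏ i, (w (y i))⁻¹ ≤ ∏ i, Real.exp ((y i : ℝ) ^ 2 / s ^ 2) := by
            apply Finset.prod_le_prod
            · intro i _; exact inv_nonneg.2 (hw0 _)
            · intro i _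
              have := Real.add_one_le_exp ((y i : ℝ) ^ 2 / s ^ 2)
              refine le_trans (le_of_eq ?_) this
              simp only [hw]
              field_simp
              ring
        _ = Real.exp (∑ i, (y i : ℝ) ^ 2 / s ^ 2) := by rw [Real.exp_sum]
        _ ≤ Real.exp d := by
            rw [Real.exp_le_exp, ← Finset.sum_div, div_le_iff₀ (by positivity)]
            exact_mod_cast hy
    have h2 : Real.exp d ≤ 3 ^ d := by
      rw [← mul_one (d : ℝ), Real.exp_nat_mul]
      gcongr
      exact Real.exp_one_lt_three.le
    have hpos : 0 < ∏ i, w (y i) := by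
      apply Finset.prod_pos
      intro i _
      simp only [hw]; positivity
    rw [Finset.prod_inv_distrib] at h1
    have h3 := h1.trans h2
    rw [inv_le_iff_one_le_mul₀ hpos] at h3
    linarith
  have : ((((Fintype.piFinset fun _ : Fin d => Finset.Icc (-(B : ℤ)) B).filter
      (fun y => ∑ i, y i ^ 2 ≤ ((d * s ^ 2 : ℕ) : ℤ))).card : ℕ) : ℝ) ≤ (15 * s) ^ d := by
    rw [Finset.card_eq_sum_ones]
    push_cast
    calc _ ≤ ∑ y ∈ (Fintype.piFinset fun _ : Fin d => Finset.Icc (-(B : ℤ)) B).filter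
          (fun y => ∑ i, y i ^ 2 ≤ ((d * s ^ 2 : ℕ) : ℤ)), 3 ^ d * ∏ i, w (y i) := by
          apply Finset.sum_le_sum
          intro y hy
          exact hpt y (Finset.mem_filter.1 hy).2
      _ ≤ ∑ y ∈ (Fintype.piFinset fun _ : Fin d => Finset.Icc (-(B : ℤ)) B), 3 ^ d * ∏ i, w (y i) := by
          apply Finset.sum_le_sum_of_subset_of_nonneg (Finset.filter_subset _ _)
          intro y _ _
          exact mul_nonneg (by positivity) (Finset.prod_nonneg fun i _ => hw0 _)
      _ = 3 ^ d * (∑ t ∈ Finset.Icc (-(B : ℤ)) B, w t) ^ d := by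
          rw [← Finset.mul_sum, ← Finset.prod_univ_sum]
          simp
      _ ≤ 3 ^ d * (5 * s) ^ d := by
          gcongr
      _ = (15 * s) ^ d := by rw [← mul_pow]; ring
  exact_mod_cast this

lemma exists_omega (P d M s : ℕ) [Fact M.Prime] (hs : 1 ≤ s) (hM : P < M)
    (hcard : P * (15 * s) ^ d < M ^ d) :
    ∃ ω : Fin d → ZMod M, ∀ c : ℕ, 1 ≤ c → c ≤ P → ∀ y : Fin d → ℤ,
      (∀ i, ((y i : ℤ) : ZMod M) = ω i * (c : ZMod M)) → ((d * s ^ 2 : ℕ) : ℤ) < ∑ i, y i ^ 2 := by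
  classical
  by_contra hcon
  push Not at hcon
  set B := d * s ^ 2 with hB
  set ball := ((Fintype.piFinset fun _ : Fin d => Finset.Icc (-(B : ℤ)) B).filter
      (fun y => ∑ i, y i ^ 2 ≤ ((d * s ^ 2 : ℕ) : ℤ))) with hball
  have hsub : (Finset.univ : Finset (Fin d → ZMod M)) ⊆
      (Finset.Icc 1 P ×ˢ ball).image (fun p => fun i => ((p.2 i : ℤ) : ZMod M) * (p.1 : ZMod M)⁻¹) := by
    intro ω _
    obtain ⟨c, h1, h2, y, hy, hle⟩ := hcon ω
    rw [Finset.mem_image]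
    refine ⟨(c, y), ?_, ?_⟩
    · rw [Finset.mem_product]
      refine ⟨Finset.mem_Icc.2 ⟨h1, h2⟩, ?_⟩
      rw [hball, Finset.mem_filter]
      refine ⟨?_, hle⟩
      rw [Fintype.mem_piFinset]
      intro i
      rw [Finset.mem_Icc, ← abs_le]
      have h3 : y i ^ 2 ≤ ∑ i, y i ^ 2 :=
        Finset.single_le_sum (f := fun i => y i ^ 2) (fun i _ => sq_nonneg _) (Finset.mem_univ i)
      have h4 : |y i| ≤ y i ^ 2 := by
        rw [← sq_abs]
        have : 0 ≤ |y i| := abs_nonneg _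
        rcases this.eq_or_lt with h | h
        · rw [← h]; norm_num
        · nlinarith
      linarith
    · funext i
      have hc : (c : ZMod M) ≠ 0 := by
        rw [Ne, ZMod.natCast_eq_zero_iff]
        intro hdvd
        have := Nat.le_of_dvd (by omega) hdvd
        omega
      simp only
      rw [hy i]
      field_simp
  have h1 := Finset.card_le_card hsub
  have h2 := h1.trans Finset.card_image_le
  rw [Finset.card_product, Nat.card_Icc, Finset.card_univ, Fintype.card_fun, ZMod.card,
    Fintype.card_fin, Nat.add_sub_cancel] at h2
  have h3 := Nat.mul_le_mul_left P (ball_card d s B hs)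
  exact absurd (h2.trans h3) (by omega)

lemma exists_alpha (N d M Lb : ℕ) [NeZero M] (hLb : Lb ≤ M) (S : Finset (Fin d → Fin Lb))
    (ω : Fin d → ZMod M) : ∃ α : Fin d → ZMod M, ∃ A : Finset ℕ, A ⊆ Finset.Icc 1 N ∧
      (∀ a ∈ A, ∃ x ∈ S, ∀ i, (((x i : Fin Lb) : ℕ) : ZMod M) = ω i * (a : ZMod M) + α i) ∧
      N * S.card ≤ M ^ d * A.card := by
  classical
  by_contra hcon
  push Not at hcon
  set A : (Fin d → ZMod M) → Finset ℕ := fun α => (Finset.Icc 1 N).filter (fun a =>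
    ∃ x ∈ S, ∀ i, (((x i : Fin Lb) : ℕ) : ZMod M) = ω i * (a : ZMod M) + α i) with hA
  have h1 : ∀ α, M ^ d * (A α).card < N * S.card := fun α =>
    hcon α (A α) (Finset.filter_subset _ _) (fun a ha => (Finset.mem_filter.1 ha).2)
  have h2 : N * S.card ≤ ∑ α, (A α).card := by
    have e : ∑ α, (A α).card = ∑ a ∈ Finset.Icc 1 N, ((Finset.univ : Finset (Fin d → ZMod M)).filter (fun α =>
       ∃ x ∈ S, ∀ i, (((x i : Fin Lb) : ℕ) : ZMod M) = ω i * (a : ZMod M) + α i)).card := by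
      simp only [hA, Finset.card_filter]
      rw [Finset.sum_comm]
    rw [e]
    have : N * S.card = ∑ a ∈ Finset.Icc 1 N, S.card := by simp
    rw [this]
    apply Finset.sum_le_sum
    intro a _
    apply Finset.card_le_card_of_injOn
      (fun x => fun i => (((x i : Fin Lb) : ℕ) : ZMod M) - ω i * (a : ZMod M))
    · intro x hx
      simp only [Finset.coe_filter, Finset.mem_univ, true_and, Set.mem_ofPred_eq]
      exact ⟨x, hx, fun i => by ring⟩
    · intro x _ y _ hxy
      funext i
      have := congrFun hxy i
      simp only [sub_left_inj] at this
      rw [ZMod.natCast_eq_natCast_iff'] at this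
      rw [Nat.mod_eq_of_lt (by omega), Nat.mod_eq_of_lt (by omega)] at this
      exact Fin.ext this
  have h3 : ∑ α, M ^ d * (A α).card < ∑ _α : Fin d → ZMod M, N * S.card := by
    apply Finset.sum_lt_sum_of_nonempty Finset.univ_nonempty
    intro α _
    exact h1 α
  rw [← Finset.mul_sum, Finset.sum_const, Finset.card_univ, Fintype.card_fun, ZMod.card,
    Fintype.card_fin, smul_eq_mul] at h3
  have h4 := Nat.mul_le_mul_left (M ^ d) h2
  omega

lemma var_sum {ι : Type*} [Fintype ι] (h : ι → ℝ) (h0 : ∑ t, h t = 0) (v : ℝ)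
    (hv : ∑ t, h t ^ 2 ≤ Fintype.card ι * v) (d : ℕ) :
    ∑ x : Fin d → ι, (∑ i, h (x i)) ^ 2 ≤ d * (Fintype.card ι : ℝ) ^ d * v := by
  induction d with
  | zero => simp
  | succ d ih =>
    rw [← (Fin.consEquiv (fun _ : Fin (d + 1) => ι)).sum_comp, Fintype.sum_prod_type]
    simp only [Fin.consEquiv_apply, Fin.sum_univ_succ, Fin.cons_zero, Fin.cons_succ]
    have e1 : ∀ t, ∑ y : Fin d → ι, (h t + ∑ i, h (y i)) ^ 2 =
        (Fintype.card ι : ℝ) ^ d * h t ^ 2 + h t * (2 * ∑ y : Fin d → ι, ∑ i, h (y i)) +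
          ∑ y : Fin d → ι, (∑ i, h (y i)) ^ 2 := by
      intro t
      simp only [add_sq, Finset.sum_add_distrib, Finset.mul_sum]
      congr 1
      congr 1
      · simp
      · refine Finset.sum_congr rfl fun y _ => Finset.sum_congr rfl fun i _ => by ring
    simp only [e1, Finset.sum_add_distrib]
    rw [← Finset.mul_sum, ← Finset.sum_mul, h0, zero_mul, add_zero, Finset.sum_const,
      Finset.card_univ, nsmul_eq_mul]
    have hc : (0 : ℝ) ≤ Fintype.card ι := by positivity
    have h1 := mul_le_mul_of_nonneg_left hv (pow_nonneg hc d)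
    have h2 := mul_le_mul_of_nonneg_left ih hc
    push_cast
    rw [pow_succ]
    nlinarith

lemma window (d L H : ℕ) (hL : 0 < L) (hH : 2 * d * L ^ 4 ≤ H ^ 2) (hH0 : 0 < H) :
    ∃ μ : ℤ, L ^ d ≤ 2 * ((Finset.univ : Finset (Fin d → Fin L)).filter (fun x =>
      μ - H ≤ ((∑ i, (x i : ℕ) ^ 2 : ℕ) : ℤ) ∧ ((∑ i, (x i : ℕ) ^ 2 : ℕ) : ℤ) ≤ μ + H + 1)).card := by
  classical
  have hL' : (0 : ℝ) < L := by exact_mod_cast hL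
  set μ : ℝ := (∑ t : Fin L, ((t : ℕ) : ℝ) ^ 2) / L with hμ
  have hb : ∀ t : Fin L, ((t : ℕ) : ℝ) ^ 2 ≤ (L : ℝ) ^ 2 := by
    intro t
    have : ((t : ℕ) : ℝ) ≤ L := by exact_mod_cast t.2.le
    gcongr
  have hμ0 : 0 ≤ μ := by
    rw [hμ]; positivity
  have hμ1 : μ ≤ (L : ℝ) ^ 2 := by
    rw [hμ, div_le_iff₀ hL']
    calc _ ≤ ∑ t : Fin L, (L : ℝ) ^ 2 := Finset.sum_le_sum fun t _ => hb t
      _ = _ := by simp; ring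
  have hvar := var_sum (fun t : Fin L => ((t : ℕ) : ℝ) ^ 2 - μ) (by
      rw [Finset.sum_sub_distrib, hμ]
      simp
      field_simp
      simp) ((L : ℝ) ^ 4) (by
      calc _ ≤ ∑ t : Fin L, (L : ℝ) ^ 4 := by
            apply Finset.sum_le_sum
            intro t _
            have h1 := hb t
            have h2 : (0 : ℝ) ≤ ((t : ℕ) : ℝ) ^ 2 := by positivity
            have : |((t : ℕ) : ℝ) ^ 2 - μ| ≤ (L : ℝ) ^ 2 := by
              rw [abs_le]; constructor <;> linarith
            calc (((t : ℕ) : ℝ) ^ 2 - μ) ^ 2 = |((t : ℕ) : ℝ) ^ 2 - μ| ^ 2 := by rw [sq_abs]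
              _ ≤ ((L : ℝ) ^ 2) ^ 2 := by gcongr
              _ = _ := by ring
        _ = _ := by simp) d
  rw [Fintype.card_fin] at hvar
  refine ⟨⌊d * μ⌋, ?_⟩
  set Wd := ((Finset.univ : Finset (Fin d → Fin L)).filter (fun x =>
      ⌊d * μ⌋ - H ≤ ((∑ i, (x i : ℕ) ^ 2 : ℕ) : ℤ) ∧
      ((∑ i, (x i : ℕ) ^ 2 : ℕ) : ℤ) ≤ ⌊d * μ⌋ + H + 1)) with hWd
  have hcompl : ((Wdᶜ.card : ℕ) : ℝ) * (H : ℝ) ^ 2 ≤ d * (L : ℝ) ^ d * (L : ℝ) ^ 4 := by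
    refine le_trans ?_ hvar
    rw [← nsmul_eq_mul, ← Finset.sum_const]
    refine le_trans ?_ (Finset.sum_le_sum_of_subset_of_nonneg (Finset.subset_univ Wdᶜ)
      (fun x _ _ => sq_nonneg _))
    apply Finset.sum_le_sum
    intro x hx
    rw [Finset.mem_compl, hWd, Finset.mem_filter, not_and] at hx
    have hx := hx (Finset.mem_univ _)
    rw [← sq_abs (∑ i, _)]
    have hHr : (0 : ℝ) ≤ H := by positivity
    apply pow_le_pow_left₀ hHr
    by_contra hlt
    push Not at hlt
    apply hx
    rw [Finset.sum_sub_distrib, Finset.sum_const, Finset.card_univ, Fintype.card_fin, nsmul_eq_mul,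
      abs_lt] at hlt
    have f1 := Int.floor_le (d * μ)
    have f2 := Int.lt_floor_add_one (d * μ)
    constructor
    · have : ((⌊d * μ⌋ - H : ℤ) : ℝ) ≤ (((∑ i, (x i : ℕ) ^ 2 : ℕ) : ℤ) : ℝ) := by
        push_cast
        linarith [hlt.1]
      exact_mod_cast this
    · have : (((∑ i, (x i : ℕ) ^ 2 : ℕ) : ℤ) : ℝ) ≤ ((⌊d * μ⌋ + H + 1 : ℤ) : ℝ) := by
        push_cast
        linarith [hlt.2]
      exact_mod_cast this
  have hH' : 2 * (d : ℝ) * (L : ℝ) ^ 4 ≤ (H : ℝ) ^ 2 := by exact_mod_cast hH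
  have hHp : (0 : ℝ) < (H : ℝ) ^ 2 := by positivity
  have h1 : 2 * ((Wdᶜ.card : ℕ) : ℝ) ≤ (L : ℝ) ^ d := by
    have hLd : (0 : ℝ) ≤ (L : ℝ) ^ d := by positivity
    have h2 := mul_le_mul_of_nonneg_left hH' hLd
    have : 2 * ((Wdᶜ.card : ℕ) : ℝ) * (H : ℝ) ^ 2 ≤ (L : ℝ) ^ d * (H : ℝ) ^ 2 := by nlinarith
    exact le_of_mul_le_mul_right this hHp
  have h1' : 2 * Wdᶜ.card ≤ L ^ d := by exact_mod_cast h1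
  have h2 := Finset.card_add_card_compl Wd
  rw [Fintype.card_fun, Fintype.card_fin, Fintype.card_fin] at h2
  omega

lemma exists_z (d L H N0 δ T : ℕ) (hL : 0 < L) (hH : 2 * d * L ^ 4 ≤ H ^ 2) (hH0 : 0 < H)
    (hδ : δ ≤ T) (A' : Finset ℕ) (hA' : A' ⊆ Finset.Icc 1 N0) :
    ∃ z : ℤ, ∃ S : Finset (Fin d → Fin L), (∀ x ∈ S, ∃ a' ∈ A', ∃ r, r < δ ∧
      ((∑ i, (x i : ℕ) ^ 2 : ℕ) : ℤ) = z + a' * (T : ℤ) + r) ∧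
      L ^ d * (A'.card * δ) ≤ 2 * (2 * H + (N0 + 1) * T + 2) * S.card := by
  classical
  obtain ⟨μ, hμ⟩ := window d L H hL hH hH0
  set Wd := ((Finset.univ : Finset (Fin d → Fin L)).filter (fun x =>
      μ - H ≤ ((∑ i, (x i : ℕ) ^ 2 : ℕ) : ℤ) ∧
      ((∑ i, (x i : ℕ) ^ 2 : ℕ) : ℤ) ≤ μ + H + 1)) with hWd
  by_contra hcon
  push Not at hcon
  set P : (Fin d → Fin L) → ℤ → Prop := fun x z => ∃ a' ∈ A', ∃ r, r < δ ∧
      ((∑ i, (x i : ℕ) ^ 2 : ℕ) : ℤ) = z + a' * (T : ℤ) + r with hP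
  have h1 : ∀ z, 2 * (2 * H + (N0 + 1) * T + 2) * (Finset.univ.filter (fun x => P x z)).card <
      L ^ d * (A'.card * δ) := fun z =>
    hcon z (Finset.univ.filter (fun x => P x z)) (fun x hx => (Finset.mem_filter.1 hx).2)
  set Z := Finset.Icc (μ - H - (N0 + 1) * T) (μ + H + 1) with hZ
  have hZc : Z.card = 2 * H + (N0 + 1) * T + 2 := by
    rw [hZ, Int.card_Icc]
    have : μ + H + 1 + 1 - (μ - H - (N0 + 1) * T) = ((2 * H + (N0 + 1) * T + 2 : ℕ) : ℤ) := by
      push_cast; ring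
    rw [this, Int.toNat_natCast]
  have h2 : Wd.card * (A'.card * δ) ≤ ∑ z ∈ Z, (Finset.univ.filter (fun x => P x z)).card := by
    have e : ∑ z ∈ Z, (Finset.univ.filter (fun x => P x z)).card =
        ∑ x, (Z.filter (fun z => P x z)).card := by
      simp only [Finset.card_filter]
      rw [Finset.sum_comm]
    rw [e]
    refine le_trans ?_ (Finset.sum_le_sum_of_subset (Finset.subset_univ Wd))
    rw [← smul_eq_mul, ← Finset.sum_const]
    apply Finset.sum_le_sum
    intro x hx
    rw [hWd, Finset.mem_filter] at hx
    obtain ⟨-, hx1, hx2⟩ := hx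
    have : A'.card * δ = (A' ×ˢ Finset.range δ).card := by simp
    rw [this]
    apply Finset.card_le_card_of_injOn
      (fun p => ((∑ i, (x i : ℕ) ^ 2 : ℕ) : ℤ) - p.1 * (T : ℤ) - p.2)
    · rintro ⟨a, r⟩ hp
      simp only [Finset.coe_product, Set.mem_prod, Finset.mem_coe, Finset.mem_range] at hp
      obtain ⟨ha, hr⟩ := hp
      have ha2 := Finset.mem_Icc.1 (hA' ha)
      simp only [Finset.coe_filter, Set.mem_ofPred_eq]
      refine ⟨?_, a, ha, r, hr, by ring⟩
      rw [hZ, Finset.mem_Icc]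
      have q1 : (a : ℤ) * T ≤ N0 * T := by
        have : (a : ℤ) ≤ N0 := by exact_mod_cast ha2.2
        gcongr
      have q2 : (r : ℤ) ≤ T := by exact_mod_cast (hr.le.trans hδ)
      have q3 : (0 : ℤ) ≤ (a : ℤ) * T := by positivity
      constructor
      · have : ((N0 : ℤ) + 1) * T = N0 * T + T := by ring
        linarith
      · have : (0 : ℤ) ≤ r := by positivity
        linarith
    · rintro ⟨a, r⟩ hp ⟨b, t⟩ hq hpq
      simp only [Finset.coe_product, Set.mem_prod, Finset.mem_coe, Finset.mem_range] at hp hq hpq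
      have hr : (r : ℤ) < T := by exact_mod_cast (hp.2.trans_le hδ)
      have ht : (t : ℤ) < T := by exact_mod_cast (hq.2.trans_le hδ)
      have heq : ((a : ℤ) - b) * T = t - r := by linarith
      have hab : (a : ℤ) - b = 0 := by
        by_contra hne
        have h0r : (0 : ℤ) ≤ r := by positivity
        have h0t : (0 : ℤ) ≤ t := by positivity
        rcases lt_or_gt_of_ne hne with h | h
        · have : ((a : ℤ) - b) ≤ -1 := by omega
          nlinarith
        · have : 1 ≤ ((a : ℤ) - b) := by omega
          nlinarith
      rw [hab, zero_mul] at heq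
      ext
      · simp only; omega
      · simp only; omega
  have h3 : ∑ z ∈ Z, 2 * (2 * H + (N0 + 1) * T + 2) * (Finset.univ.filter (fun x => P x z)).card <
      ∑ z ∈ Z, L ^ d * (A'.card * δ) := by
    apply Finset.sum_lt_sum_of_nonempty
    · rw [← Finset.card_pos, hZc]; omega
    · intro z _
      exact h1 z
  rw [← Finset.mul_sum, Finset.sum_const, hZc, smul_eq_mul] at h3
  set K := 2 * H + (N0 + 1) * T + 2 with hK
  have hK0 : 0 < K := by omega
  have h4 : 2 * ∑ z ∈ Z, (Finset.univ.filter (fun x => P x z)).card < L ^ d * (A'.card * δ) := by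
    apply lt_of_mul_lt_mul_left (a := K) _ (Nat.zero_le _)
    calc _ = _ := by ring
      _ < _ := h3
  have h5 := Nat.mul_le_mul_right (A'.card * δ) hμ
  nlinarith

lemma rkD_bdd (k D N : ℕ) : BddAbove {m | ∃ A : Finset ℕ, A ⊆ Finset.Icc 1 N ∧
    ¬ HasProgression A k D ∧ A.card = m} := by
  refine ⟨N, ?_⟩
  rintro m ⟨A, hA, -, rfl⟩
  simpa using Finset.card_le_card hA

lemma le_rkD (k D N : ℕ) (A : Finset ℕ) (hA : A ⊆ Finset.Icc 1 N) (h : ¬ HasProgression A k D) :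
    A.card ≤ rkD k D N :=
  le_csSup (rkD_bdd k D N) ⟨A, hA, h, rfl⟩

lemma exists_rkD (k D N : ℕ) (hk : 1 ≤ k) : ∃ A : Finset ℕ, A ⊆ Finset.Icc 1 N ∧
    ¬ HasProgression A k D ∧ A.card = rkD k D N := by
  have := Nat.sSup_mem (s := {m | ∃ A : Finset ℕ, A ⊆ Finset.Icc 1 N ∧
    ¬ HasProgression A k D ∧ A.card = m}) ⟨0, ∅, by simp, by
      rintro ⟨Q, -, -, h⟩
      obtain ⟨m, hm, -⟩ := h 1 (Finset.mem_Icc.2 ⟨le_rfl, hk⟩)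
      simp at hm, by simp⟩ (rkD_bdd k D N)
  exact this

lemma one_le_rkD (k D N : ℕ) (hk : D + 1 ≤ k) (hN : 1 ≤ N) : 1 ≤ rkD k D N := by
  have := le_rkD k D N {1} (by simpa using hN) (by
    rintro ⟨Q, h0, hD, h⟩
    have hz : Q - Polynomial.C 1 = 0 := by
      by_contra hne
      have hroots : (Finset.Icc 1 k).image (fun j : ℕ => (j : ℝ)) ⊆ (Q - Polynomial.C 1).roots.toFinset := by
        intro y hy
        rw [Finset.mem_image] at hy
        obtain ⟨j, hj, rfl⟩ := hy
        obtain ⟨m, hm, hm2⟩ := h j hj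
        rw [Finset.mem_singleton] at hm
        subst hm
        rw [Multiset.mem_toFinset, Polynomial.mem_roots hne, Polynomial.IsRoot, Polynomial.eval_sub,
          ← hm2]
        simp
      have h1 := Finset.card_le_card hroots
      rw [Finset.card_image_of_injective _ Nat.cast_injective, Nat.card_Icc] at h1
      have h2 := Multiset.toFinset_card_le (Q - Polynomial.C 1).roots
      have h3 := Polynomial.card_roots' (Q - Polynomial.C 1)
      rw [Polynomial.natDegree_sub_C] at h3
      omega
    have : Q = Polynomial.C 1 := sub_eq_zero.1 hz
    rw [this, Polynomial.natDegree_C] at h0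
    omega)
  simpa using this

set_option maxHeartbeats 1000000 in
lemma key_prop (k D N d N0 : ℕ) (hk : 2 * D + 1 ≤ k) (hN : 1 ≤ N) (hd : 1 ≤ d) (hN0 : 1 ≤ N0)
    (h : (N : ℝ) ^ ((2 : ℝ) / d) ≤ N0 * √d) :
    N * rkD k (2 * D) N0 ≤ 17432 * 4 ^ D * N0 * 2 ^ (D * d) * rkD k D N := by
  obtain ⟨A', hA'1, hA'2, hA'3⟩ := exists_rkD k (2 * D) N0 (by omega)
  set θ : ℝ := (N : ℝ) ^ ((1 : ℝ) / d) with hθ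
  have hN' : (1 : ℝ) ≤ N := by exact_mod_cast hN
  have hd' : (1 : ℝ) ≤ d := by exact_mod_cast hd
  have hθ1 : 1 ≤ θ := Real.one_le_rpow hN' (by positivity)
  have hθd : θ ^ d = N := by
    rw [hθ, ← Real.rpow_natCast, ← Real.rpow_mul (by positivity), one_div,
      inv_mul_cancel₀ (by positivity), Real.rpow_one]
  have hθ2 : θ ^ 2 = (N : ℝ) ^ ((2 : ℝ) / d) := by
    rw [hθ, ← Real.rpow_natCast, ← Real.rpow_mul (by positivity)]
    congr 1
    push_cast
    ring
  rw [← hθ2] at h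
  set s := 2 ^ D * N with hs
  have hs1 : 1 ≤ s := Nat.mul_pos (by positivity) hN
  have hs1' : (1 : ℝ) ≤ s := by exact_mod_cast hs1
  set δ := d * N ^ 2 with hδ
  set T := 4 ^ D * δ with hT
  have hTs : T = d * s ^ 2 := by
    rw [hT, hδ, hs, mul_pow, ← pow_mul, mul_comm D 2, pow_mul]
    norm_num
    ring
  have hδ0 : 0 < δ := by rw [hδ]; positivity
  have hT0 : 0 < T := by rw [hT]; positivity
  have h2D : (1 : ℝ) ≤ 2 ^ D := one_le_pow₀ (by norm_num)
  set Y := ⌈15 * (s : ℝ) * 2 ^ D * θ⌉₊ with hY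
  have hYge : 15 * (s : ℝ) * 2 ^ D * θ ≤ Y := Nat.le_ceil _
  have hY1 : 1 ≤ (s : ℝ) * 2 ^ D * θ := by
    have := one_le_mul_of_one_le_of_one_le (one_le_mul_of_one_le_of_one_le hs1' h2D) hθ1
    exact this
  have hYle : (Y : ℝ) ≤ 16 * ((s : ℝ) * 2 ^ D * θ) := by
    have := Nat.ceil_lt_add_one (a := 15 * (s : ℝ) * 2 ^ D * θ) (by positivity)
    rw [← hY] at this
    nlinarith
  have hY0 : Y ≠ 0 := by
    intro h0
    rw [h0] at hYge
    push_cast at hYge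
    nlinarith
  obtain ⟨M, hMp, hYM, hMY⟩ := Nat.exists_prime_lt_and_le_two_mul Y hY0
  have : Fact M.Prime := ⟨hMp⟩
  have : NeZero M := ⟨hMp.ne_zero⟩
  have hYM' : (Y : ℝ) < M := by exact_mod_cast hYM
  have hMY' : (M : ℝ) ≤ 2 * Y := by exact_mod_cast hMY
  have hPM : 2 ^ D * N < M := by
    have : (s : ℝ) < M := by
      have : (s : ℝ) ≤ s * 2 ^ D * θ := by
        have := one_le_mul_of_one_le_of_one_le h2D hθ1
        nlinarith
      nlinarith
    exact_mod_cast this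
  have hcard : (2 ^ D * N) * (15 * s) ^ d < M ^ d := by
    have : ((2 : ℝ) ^ D * N) * (15 * s) ^ d < (M : ℝ) ^ d := by
      calc ((2 : ℝ) ^ D * N) * (15 * s) ^ d ≤ ((2 : ℝ) ^ D) ^ d * N * (15 * s) ^ d := by
            gcongr
            exact le_self_pow₀ h2D (by omega)
        _ = (15 * (s : ℝ) * 2 ^ D * θ) ^ d := by
            rw [mul_pow _ θ, hθd, mul_pow (15 * (s : ℝ))]; ring
        _ < (M : ℝ) ^ d := by
            apply pow_lt_pow_left₀ (by linarith) (by positivity) (by omega)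
    exact_mod_cast this
  obtain ⟨ω, hω⟩ := exists_omega (2 ^ D * N) d M s hs1 hPM hcard
  set L := (M - 1) / 2 ^ D + 1 with hL
  have hL1 : 2 ^ D * (L - 1) ≤ M - 1 := by
    rw [hL, Nat.add_sub_cancel]
    exact Nat.mul_div_le _ _
  have hL2 : M ≤ 2 ^ D * L := by
    have := Nat.lt_mul_div_succ (M - 1) (show 0 < 2 ^ D by positivity)
    rw [hL]
    omega
  have hL3 : L ≤ M := by
    have : (M - 1) / 2 ^ D ≤ M - 1 := Nat.div_le_self _ _
    have := hMp.pos
    omega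
  have hL0 : 0 < L := Nat.succ_pos _
  have hL4 : (2 : ℤ) ^ D * ((L : ℤ) - 1) < M := by
    have h1 : ((2 ^ D * (L - 1) : ℕ) : ℤ) ≤ ((M - 1 : ℕ) : ℤ) := by exact_mod_cast hL1
    have := hMp.pos
    push_cast [Nat.cast_sub hL0, Nat.cast_sub this] at h1
    linarith
  have hL5 : (L : ℝ) ≤ 33 * (s * θ) := by
    have h1 : (2 : ℝ) ^ D * ((L : ℝ) - 1) < M := by exact_mod_cast hL4
    have h2 : (2 : ℝ) ^ D * ((L : ℝ) - 1) < 2 ^ D * (32 * (s * θ)) := by nlinarith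
    have h3 := lt_of_mul_lt_mul_left h2 (by positivity)
    have h4 := one_le_mul_of_one_le_of_one_le hs1' hθ1
    linarith
  set q := ⌈√(d : ℝ)⌉₊ with hq
  have hq1 : √(d : ℝ) ≤ q := Nat.le_ceil _
  have hsd : 1 ≤ √(d : ℝ) := by rw [Real.one_le_sqrt]; exact hd'
  have hq2 : (q : ℝ) ≤ 2 * √(d : ℝ) := by
    have := Nat.ceil_lt_add_one (a := √(d : ℝ)) (by positivity)
    rw [← hq] at this
    linarith
  have hdq : d ≤ q ^ 2 := by
    have : (d : ℝ) ≤ (q : ℝ) ^ 2 := by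
      calc (d : ℝ) = √(d : ℝ) ^ 2 := (Real.sq_sqrt (by positivity)).symm
        _ ≤ _ := by gcongr
    exact_mod_cast this
  have hq0 : 0 < q := by
    rcases Nat.eq_zero_or_pos q with h0 | h0
    · rw [h0] at hdq; omega
    · exact h0
  set H := L ^ 2 * (2 * q) with hH
  have hH1 : 2 * d * L ^ 4 ≤ H ^ 2 := by
    have : H ^ 2 = 4 * q ^ 2 * L ^ 4 := by rw [hH]; ring
    rw [this]
    apply Nat.mul_le_mul_right
    omega
  have hH0 : 0 < H := by rw [hH]; positivity
  have hHT : H ≤ 4356 * (N0 * T) := by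
    have : (H : ℝ) ≤ 4356 * (N0 * T) := by
      calc (H : ℝ) = (L : ℝ) ^ 2 * (2 * q) := by rw [hH]; push_cast; ring
        _ ≤ (33 * (s * θ)) ^ 2 * (2 * (2 * √(d : ℝ))) := by gcongr
        _ = 4356 * (s : ℝ) ^ 2 * √(d : ℝ) * θ ^ 2 := by ring
        _ ≤ 4356 * (s : ℝ) ^ 2 * √(d : ℝ) * (N0 * √(d : ℝ)) := by gcongr
        _ = 4356 * (s : ℝ) ^ 2 * N0 * (√(d : ℝ) ^ 2) := by ring
        _ = 4356 * (N0 * T) := by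
          rw [Real.sq_sqrt (by positivity), hTs]; push_cast; ring
    exact_mod_cast this
  obtain ⟨z, S, hS1, hS2⟩ := exists_z d L H N0 δ T hL0 hH1 hH0
    (Nat.le_mul_of_pos_left _ (by positivity)) A' hA'1
  obtain ⟨α, A, hA1, hA2, hA3⟩ := exists_alpha N d M L hL3 S ω
  have hnp : ¬ HasProgression A k D := by
    apply no_prog k D N d M L δ hk hL4 hδ0 A' hA'2 ω α _ z A hA1
    · intro a ha
      obtain ⟨x, hx, hxa⟩ := hA2 a ha
      exact ⟨fun i => (x i : ℕ), fun i => (x i).2, hxa, hS1 x hx⟩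
    · intro c h1 h2 y hy
      have := hω c h1 h2 y hy
      rw [← hTs] at this
      exact this
  have hAr := le_rkD k D N A hA1 hnp
  rw [← hA'3]
  refine le_trans ?_ (Nat.mul_le_mul_left _ hAr)
  have e1 : 2 * H + (N0 + 1) * T + 2 ≤ 8716 * (N0 * T) := by
    have : 1 ≤ N0 * T := Nat.mul_pos hN0 hT0
    have : T ≤ N0 * T := Nat.le_mul_of_pos_left _ hN0
    have e0 : (N0 + 1) * T = N0 * T + T := by ring
    rw [e0]
    generalize N0 * T = NT at *
    omega
  have e2 : L ^ d * A'.card ≤ 17432 * 4 ^ D * N0 * S.card := by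
    apply Nat.le_of_mul_le_mul_right _ hδ0
    calc L ^ d * A'.card * δ = L ^ d * (A'.card * δ) := by ring
      _ ≤ 2 * (2 * H + (N0 + 1) * T + 2) * S.card := hS2
      _ ≤ 2 * (8716 * (N0 * T)) * S.card := by gcongr
      _ = 17432 * 4 ^ D * N0 * S.card * δ := by rw [hT]; ring
  have hLd : 0 < L ^ d := by positivity
  apply Nat.le_of_mul_le_mul_right _ hLd
  calc N * A'.card * L ^ d = N * (L ^ d * A'.card) := by ring
    _ ≤ N * (17432 * 4 ^ D * N0 * S.card) := by gcongr
    _ = 17432 * 4 ^ D * N0 * (N * S.card) := by ring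
    _ ≤ 17432 * 4 ^ D * N0 * (M ^ d * A.card) := by gcongr
    _ ≤ 17432 * 4 ^ D * N0 * ((2 ^ D * L) ^ d * A.card) := by gcongr
    _ = 17432 * 4 ^ D * N0 * 2 ^ (D * d) * A.card * L ^ d := by
      rw [mul_pow, ← pow_mul]; ring

lemma id1 (n D L : ℝ) (hn : 1 < n) (hD : 0 < D) (hL : 0 < L) :
    D * (2 ^ ((n - 1) / 2) * (L / D) ^ (1 / n)) = 2 ^ ((n - 1) / 2) * D ^ ((n - 1) / n) * L ^ (1 / n) := by
  apply Real.log_injOn_pos (Set.mem_Ioi.2 (by positivity)) (Set.mem_Ioi.2 (by positivity))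
  rw [Real.log_mul (by positivity) (by positivity), Real.log_mul (by positivity) (by positivity),
    Real.log_mul (by positivity) (by positivity), Real.log_mul (by positivity) (by positivity),
    Real.log_rpow (by positivity), Real.log_rpow (by positivity), Real.log_rpow (by positivity),
    Real.log_rpow (by positivity), Real.log_div (by positivity) (by positivity)]
  field_simp
  ring

lemma id3 (n D L : ℝ) (hn : 1 < n) (hD : 0 < D) (hL : 0 < L) :
    L / (2 ^ ((n - 1) / 2) * (L / D) ^ (1 / n)) =
      2 ^ (-((n - 1) / 2)) * D ^ (1 / n) * L ^ ((n - 1) / n) := by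
  apply Real.log_injOn_pos (Set.mem_Ioi.2 (by positivity)) (Set.mem_Ioi.2 (by positivity))
  rw [Real.log_div (by positivity) (by positivity), Real.log_mul (by positivity) (by positivity),
    Real.log_mul (by positivity) (by positivity), Real.log_mul (by positivity) (by positivity),
    Real.log_rpow (by positivity), Real.log_rpow (by positivity), Real.log_rpow (by positivity),
    Real.log_rpow (by positivity), Real.log_rpow (by positivity),
    Real.log_div (by positivity) (by positivity)]
  field_simp
  ring

lemma id2 (n D L : ℝ) (hn : 1 < n) (hD : 0 < D) (hL : 0 < L) :
    2 ^ ((n - 2) / 2) * (2 * D) ^ ((n - 2) / (n - 1)) *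
      (2 * L / (2 ^ ((n - 1) / 2) * (L / D) ^ (1 / n))) ^ (1 / (n - 1)) =
      D * (2 ^ ((n - 1) / 2) * (L / D) ^ (1 / n)) := by
  have hn1 : n - 1 ≠ 0 := by linarith
  apply Real.log_injOn_pos (Set.mem_Ioi.2 (by positivity)) (Set.mem_Ioi.2 (by positivity))
  rw [Real.log_mul (by positivity) (by positivity), Real.log_mul (by positivity) (by positivity),
    Real.log_mul (by positivity) (by positivity), Real.log_mul (by positivity) (by positivity),
    Real.log_rpow (by positivity), Real.log_rpow (by positivity), Real.log_rpow (by positivity),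
    Real.log_rpow (by positivity), Real.log_rpow (by positivity),
    Real.log_div (by positivity) (by positivity), Real.log_div (by positivity) (by positivity),
    Real.log_mul (by positivity) (by positivity), Real.log_mul (by positivity) (by positivity),
    Real.log_mul (by positivity) (by positivity),
    Real.log_rpow (by positivity), Real.log_rpow (by positivity),
    Real.log_div (by positivity) (by positivity)]
  field_simp
  ring

lemma ext_small (k D : ℕ) (hk : D + 1 ≤ k) (p b q : ℝ) (hp0 : 0 ≤ p) (hp1 : p ≤ 1) (hb : 0 ≤ b)
    (h : ∃ C : ℝ, 0 < C ∧ ∀ᶠ N : ℕ in Filter.atTop, C * (Real.logb 2 N) ^ p /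
      (2 : ℝ) ^ (b * (Real.logb 2 N) ^ q) ≤ (rkD k D N : ℝ) / N) :
    ∃ C : ℝ, 0 < C ∧ ∀ N : ℕ, 1 ≤ N → C * (Real.logb 2 N) ^ p /
      (2 : ℝ) ^ (b * (Real.logb 2 N) ^ q) ≤ (rkD k D N : ℝ) / N := by
  obtain ⟨C, hC, hev⟩ := h
  obtain ⟨N1, hN1⟩ := Filter.eventually_atTop.1 hev
  set K : ℝ := (N1 : ℝ) + 1 with hK
  have hK1 : 1 ≤ K := by rw [hK]; linarith [Nat.cast_nonneg (α := ℝ) N1]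
  refine ⟨min C (1 / K ^ 2), lt_min hC (by positivity), ?_⟩
  intro N hN
  have hN' : (1 : ℝ) ≤ N := by exact_mod_cast hN
  have hL : 0 ≤ Real.logb 2 N := Real.logb_nonneg (by norm_num) hN'
  rcases le_or_gt N1 N with h1 | h1
  · refine le_trans ?_ (hN1 N h1)
    have := min_le_left C (1 / K ^ 2)
    gcongr
  · have hNK : (N : ℝ) ≤ K := by
      have : (N : ℝ) < N1 := by exact_mod_cast h1
      rw [hK]; linarith
    have hr : (1 : ℝ) ≤ rkD k D N := by exact_mod_cast one_le_rkD k D N hk hN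
    have hLK : Real.logb 2 N ≤ K := by
      refine le_trans ?_ hNK
      rw [Real.logb_le_iff_le_rpow (by norm_num) (by positivity), Real.rpow_natCast]
      exact_mod_cast (Nat.lt_two_pow_self (n := N)).le
    calc min C (1 / K ^ 2) * (Real.logb 2 N) ^ p / (2 : ℝ) ^ (b * (Real.logb 2 N) ^ q)
        ≤ min C (1 / K ^ 2) * (Real.logb 2 N) ^ p / 1 := by
          apply div_le_div_of_nonneg_left _ one_pos
          · exact Real.one_le_rpow (by norm_num) (by positivity)
          · have : 0 < min C (1 / K ^ 2) := lt_min hC (by positivity)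
            positivity
      _ ≤ 1 / K ^ 2 * K := by
          rw [div_one]
          gcongr
          · exact min_le_right _ _
          · calc (Real.logb 2 N) ^ p ≤ K ^ p := by gcongr
              _ ≤ K ^ (1 : ℝ) := Real.rpow_le_rpow_of_exponent_le hK1 hp1
              _ = K := Real.rpow_one K
      _ = 1 / K := by field_simp
      _ ≤ 1 / N := by gcongr
      _ ≤ _ := by gcongr

lemma key_real (k D N d N0 : ℕ) (hk : 2 * D + 1 ≤ k) (hN : 1 ≤ N) (hd : 1 ≤ d) (hN0 : 1 ≤ N0)
    (h : (2 : ℝ) ^ (2 * Real.logb 2 N / d) ≤ N0 * √d) :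
    1 / (17432 * 4 ^ D) * (1 / (2 : ℝ) ^ ((D : ℝ) * d)) * ((rkD k (2 * D) N0 : ℝ) / N0) ≤
      (rkD k D N : ℝ) / N := by
  have hN' : (1 : ℝ) ≤ N := by exact_mod_cast hN
  have hN0' : (1 : ℝ) ≤ N0 := by exact_mod_cast hN0
  have h1 : (N : ℝ) ^ ((2 : ℝ) / d) ≤ N0 * √d := by
    refine le_trans (le_of_eq ?_) h
    have : 2 * Real.logb 2 N / d = Real.logb 2 N * (2 / d) := by ring
    rw [this, Real.rpow_mul (by norm_num), Real.rpow_logb (by norm_num) (by norm_num) (by linarith)]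
  have h2 := key_prop k D N d N0 hk hN hd hN0 h1
  have h3 : (N : ℝ) * rkD k (2 * D) N0 ≤ 17432 * 4 ^ D * N0 * 2 ^ (D * d) * rkD k D N := by
    exact_mod_cast h2
  have h4 : (2 : ℝ) ^ ((D : ℝ) * d) = 2 ^ (D * d) := by
    rw [← Real.rpow_natCast]; push_cast; rfl
  rw [h4, le_div_iff₀ (by positivity)]
  have e : 1 / (17432 * 4 ^ D) * (1 / (2 : ℝ) ^ (D * d)) * ((rkD k (2 * D) N0 : ℝ) / N0) * N =
    ((N : ℝ) * rkD k (2 * D) N0) / (17432 * 4 ^ D * N0 * 2 ^ (D * d)) := by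
    field_simp
  rw [e, div_le_iff₀ (by positivity)]
  linarith

lemma tendsto_L : Filter.Tendsto (fun N : ℕ => Real.logb 2 (N : ℝ)) Filter.atTop Filter.atTop :=
  (Real.tendsto_logb_atTop (by norm_num)).comp tendsto_natCast_atTop_atTop

lemma tendsto_Lpow (a p : ℝ) (ha : 0 < a) (hp : 0 < p) :
    Filter.Tendsto (fun N : ℕ => a * (Real.logb 2 (N : ℝ)) ^ p) Filter.atTop Filter.atTop :=
  Filter.Tendsto.const_mul_atTop ha ((tendsto_rpow_atTop hp).comp tendsto_L)

lemma d0_eq (n D L : ℝ) (hD : 0 < D) (hL : 0 < L) :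
    2 ^ ((n - 1) / 2) * (L / D) ^ (1 / n) = (2 ^ ((n - 1) / 2) * (1 / D) ^ (1 / n)) * L ^ (1 / n) := by
  have : L / D = 1 / D * L := by ring
  rw [this, Real.mul_rpow (by positivity) (by positivity)]
  ring

lemma base_case (k D : ℕ) (hD : 1 ≤ D) (hk : 2 * D + 1 ≤ k) :
    ∃ C : ℝ, 0 < C ∧ ∀ N : ℕ, 1 ≤ N → C * (Real.logb 2 N) ^ ((1 : ℝ) / (2 * 2)) /
      (2 : ℝ) ^ (((2 : ℝ) * 2 ^ (((2 : ℝ) - 1) / 2) * (D : ℝ) ^ (((2 : ℝ) - 1) / 2)) *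
        (Real.logb 2 N) ^ ((1 : ℝ) / 2)) ≤ (rkD k D N : ℝ) / N := by
  have hD' : (1 : ℝ) ≤ D := by exact_mod_cast hD
  have hD0 : (0 : ℝ) < D := by linarith
  apply ext_small k D (by omega) _ _ _ (by norm_num) (by norm_num) (by positivity)
  set a : ℝ := 2 ^ (((2 : ℝ) - 1) / 2) * (1 / (D : ℝ)) ^ (1 / (2 : ℝ)) with ha
  have ha0 : 0 < a := by positivity
  refine ⟨1 / (17432 * 4 ^ D) * (1 / 2 ^ (D : ℝ)) * (1 / 2) * a ^ (1 / (2 : ℝ)), by positivity, ?_⟩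
  filter_upwards [(tendsto_Lpow a (1 / 2) ha0 (by norm_num)).eventually_ge_atTop 2,
    tendsto_L.eventually_ge_atTop 1, Filter.eventually_ge_atTop 1] with N hd0 hL1 hN
  set L := Real.logb 2 (N : ℝ) with hL
  have hL0 : 0 < L := by linarith
  have hid1 := id1 2 D L (by norm_num) hD0 hL0
  have hid2 := id2 2 D L (by norm_num) hD0 hL0
  rw [d0_eq 2 D L hD0 hL0, ← ha] at hid1 hid2
  set d0 := a * L ^ (1 / (2 : ℝ)) with hd0'
  have hid2' : 2 * L / d0 = D * d0 := by
    have e1 : ((2 : ℝ) - 2) / 2 = 0 := by norm_num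
    have e2 : ((2 : ℝ) - 2) / (2 - 1) = 0 := by norm_num
    have e3 : (1 : ℝ) / (2 - 1) = 1 := by norm_num
    rw [e1, e2, e3, Real.rpow_zero, Real.rpow_zero, Real.rpow_one, one_mul, one_mul] at hid2
    exact hid2
  set d := ⌈d0⌉₊ with hd
  have hdge : d0 ≤ d := Nat.le_ceil _
  have hdlt : (d : ℝ) < d0 + 1 := Nat.ceil_lt_add_one (by linarith)
  have hd1 : 1 ≤ d := by
    have : (0 : ℝ) < d := by linarith
    exact_mod_cast this
  have hdpos : (0 : ℝ) < d := by linarith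
  have hd0pos : 0 < d0 := by linarith
  set y : ℝ := 2 ^ (2 * L / d) with hy
  have hsd : 0 < √(d : ℝ) := Real.sqrt_pos.2 hdpos
  have hyd : √(d : ℝ) ≤ y := by
    have h1 : d0 / 2 ≤ 2 * L / d := by
      have : 2 * L = D * d0 * d0 := by
        rw [← hid2']; field_simp
      rw [this, le_div_iff₀ hdpos]
      nlinarith [mul_pos hd0pos hd0pos]
    have h2 : (2 : ℝ) ^ (d0 / 2) ≤ y := Real.rpow_le_rpow_of_exponent_le (by norm_num) h1
    refine le_trans ?_ h2
    rw [Real.sqrt_le_left (by positivity)]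
    have h3 := one_add_mul_self_le_rpow_one_add (s := 1) (by norm_num) (p := d0 / 2) (by linarith)
    have h4 : (1 : ℝ) + 1 = 2 := by norm_num
    rw [h4] at h3
    have h5 : (1 + d0 / 2) ^ 2 ≤ ((2 : ℝ) ^ (d0 / 2)) ^ 2 := by
      apply pow_le_pow_left₀ (by linarith)
      linarith
    nlinarith [sq_nonneg (d0 / 2)]
  set N0 := ⌈y / √(d : ℝ)⌉₊ with hN0
  have hyd1 : 1 ≤ y / √(d : ℝ) := by rwa [le_div_iff₀ hsd, one_mul]
  have hN0ge : y / √(d : ℝ) ≤ N0 := Nat.le_ceil _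
  have hN0lt : (N0 : ℝ) < y / √(d : ℝ) + 1 := Nat.ceil_lt_add_one (by linarith)
  have hN0pos : (0 : ℝ) < N0 := by linarith
  have hN01 : 1 ≤ N0 := by exact_mod_cast hN0pos
  have hkey := key_real k D N d N0 hk hN hd1 hN01 (by
    rw [div_le_iff₀ hsd] at hN0ge
    exact hN0ge)
  refine le_trans ?_ hkey
  have hr : (1 : ℝ) ≤ rkD k (2 * D) N0 := by exact_mod_cast one_le_rkD k (2 * D) N0 hk hN01
  have hy0 : 0 < y := by positivity
  have hyle : y ≤ 2 ^ (D * d0) := by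
    rw [hy, ← hid2']
    apply Real.rpow_le_rpow_of_exponent_le (by norm_num)
    gcongr
  have h1 : 1 / 2 * (d0 ^ (1 / (2 : ℝ)) / 2 ^ (D * d0)) ≤ (rkD k (2 * D) N0 : ℝ) / N0 := by
    calc 1 / 2 * (d0 ^ (1 / (2 : ℝ)) / 2 ^ (D * d0)) ≤ 1 / 2 * (√(d : ℝ) / y) := by
          gcongr
          rw [Real.sqrt_eq_rpow]
          gcongr
      _ = 1 / (2 * (y / √(d : ℝ))) := by field_simp
      _ ≤ 1 / N0 := by
          gcongr
          linarith
      _ ≤ _ := by gcongr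
  have h2 : 1 / (2 : ℝ) ^ (D : ℝ) * (1 / 2 ^ (D * d0)) ≤ 1 / (2 : ℝ) ^ ((D : ℝ) * d) := by
    rw [one_div_mul_one_div, ← Real.rpow_add (by norm_num)]
    apply one_div_le_one_div_of_le (by positivity)
    apply Real.rpow_le_rpow_of_exponent_le (by norm_num)
    nlinarith
  have hexp : (2 : ℝ) * 2 ^ (((2 : ℝ) - 1) / 2) * (D : ℝ) ^ (((2 : ℝ) - 1) / 2) * L ^ ((1 : ℝ) / 2) =
      D * d0 + D * d0 := by
    rw [hid1]; ring
  rw [hexp, Real.rpow_add (by norm_num)]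
  have hd0p : d0 ^ (1 / (2 : ℝ)) = a ^ (1 / (2 : ℝ)) * L ^ ((1 : ℝ) / (2 * 2)) := by
    rw [hd0', Real.mul_rpow ha0.le (by positivity), ← Real.rpow_mul hL0.le]
    norm_num
  calc _ = 1 / (17432 * 4 ^ D) * (1 / (2 : ℝ) ^ (D : ℝ) * (1 / 2 ^ (D * d0))) *
        (1 / 2 * (d0 ^ (1 / (2 : ℝ)) / 2 ^ (D * d0))) := by
        rw [hd0p]
        field_simp
    _ ≤ _ := by gcongr

lemma step_case (k D : ℕ) (n : ℝ) (hn : 2 ≤ n) (hD : 1 ≤ D) (hk : 2 * D + 1 ≤ k)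
    (ih : ∃ C : ℝ, 0 < C ∧ ∀ N : ℕ, 1 ≤ N → C * (Real.logb 2 N) ^ ((1 : ℝ) / (2 * n)) /
      (2 : ℝ) ^ ((n * 2 ^ ((n - 1) / 2) * ((2 * D : ℕ) : ℝ) ^ ((n - 1) / n)) *
        (Real.logb 2 N) ^ ((1 : ℝ) / n)) ≤ (rkD k (2 * D) N : ℝ) / N) :
    ∃ C : ℝ, 0 < C ∧ ∀ N : ℕ, 1 ≤ N → C * (Real.logb 2 N) ^ ((1 : ℝ) / (2 * (n + 1))) /
      (2 : ℝ) ^ (((n + 1) * 2 ^ ((n + 1 - 1) / 2) * (D : ℝ) ^ ((n + 1 - 1) / (n + 1))) *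
        (Real.logb 2 N) ^ ((1 : ℝ) / (n + 1))) ≤ (rkD k D N : ℝ) / N := by
  obtain ⟨C, hC, ih⟩ := ih
  have hD' : (1 : ℝ) ≤ D := by exact_mod_cast hD
  have hD0 : (0 : ℝ) < D := by linarith
  have hn0 : 0 < n := by linarith
  apply ext_small k D (by omega) _ _ _ (by positivity)
    (by rw [div_le_one (by linarith)]; linarith) (by positivity)
  set a : ℝ := 2 ^ ((n + 1 - 1) / 2) * (1 / (D : ℝ)) ^ (1 / (n + 1)) with ha
  have ha0 : 0 < a := by positivity
  set b : ℝ := 2 ^ (-((n + 1 - 1) / 2)) * (D : ℝ) ^ (1 / (n + 1)) / 2 with hb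
  have hb0 : 0 < b := by positivity
  refine ⟨1 / (17432 * 4 ^ D) * (1 / 2 ^ (D : ℝ)) * (C * b ^ (1 / (2 * n))), by positivity, ?_⟩
  filter_upwards [(tendsto_Lpow a (1 / (n + 1)) ha0 (by positivity)).eventually_ge_atTop 4,
    (tendsto_Lpow b ((n + 1 - 1) / (n + 1)) hb0
      (by rw [add_sub_cancel_right]; positivity)).eventually_ge_atTop 1,
    tendsto_L.eventually_ge_atTop 1, Filter.eventually_ge_atTop 1] with N hd0 hbL hL1 hN
  set L := Real.logb 2 (N : ℝ) with hL
  have hL0 : 0 < L := by linarith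
  have hid1 := id1 (n + 1) D L (by linarith) hD0 hL0
  have hid2 := id2 (n + 1) D L (by linarith) hD0 hL0
  have hid3 := id3 (n + 1) D L (by linarith) hD0 hL0
  rw [d0_eq (n + 1) D L hD0 hL0, ← ha] at hid1 hid2 hid3
  set d0 := a * L ^ (1 / (n + 1)) with hd0'
  have hd0pos : 0 < d0 := by linarith
  have hid3' : L / (2 * d0) = b * L ^ ((n + 1 - 1) / (n + 1)) := by
    have : L / (2 * d0) = L / d0 / 2 := by field_simp
    rw [this, hid3, hb]
    ring
  set d := ⌈d0⌉₊ with hd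
  have hdge : d0 ≤ d := Nat.le_ceil _
  have hdlt : (d : ℝ) < d0 + 1 := Nat.ceil_lt_add_one (by linarith)
  have hdpos : (0 : ℝ) < d := by linarith
  have hd1 : 1 ≤ d := by exact_mod_cast hdpos
  set y : ℝ := 2 ^ (2 * L / d) with hy
  have hy0 : 0 < y := by positivity
  have hy1 : 1 ≤ y := Real.one_le_rpow (by norm_num) (by positivity)
  set N0 := ⌊y⌋₊ with hN0
  have hN0le : (N0 : ℝ) ≤ y := Nat.floor_le hy0.le
  have hN0gt : y < N0 + 1 := Nat.lt_floor_add_one y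
  have hN01 : 1 ≤ N0 := by
    rw [hN0, Nat.one_le_floor_iff]; exact hy1
  have hN01' : (1 : ℝ) ≤ N0 := by exact_mod_cast hN01
  have hN0half : y / 2 ≤ N0 := by linarith
  have hsd : 2 ≤ √(d : ℝ) := by
    apply Real.le_sqrt_of_sq_le
    linarith
  have hkey := key_real k D N d N0 hk hN hd1 hN01 (by
    show y ≤ N0 * √(d : ℝ)
    nlinarith)
  refine le_trans ?_ hkey
  have hihN := ih N0 hN01
  have hlog1 : Real.logb 2 N0 ≤ 2 * L / d0 := by
    have h1 : Real.logb 2 N0 ≤ 2 * L / d := by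
      rw [Real.logb_le_iff_le_rpow (by norm_num) (by linarith)]
      exact hN0le
    refine h1.trans ?_
    gcongr
  have hlog2 : L / (2 * d0) ≤ Real.logb 2 N0 := by
    have h1 : 2 * L / d - 1 ≤ Real.logb 2 N0 := by
      rw [Real.le_logb_iff_rpow_le (by norm_num) (by linarith), Real.rpow_sub (by norm_num),
        Real.rpow_one]
      exact hN0half
    have h2 : L / (2 * d0) ≤ L / d := by
      gcongr
      linarith
    have h3 : 2 * L / d = L / d + L / d := by ring
    rw [← hid3'] at hbL
    linarith
  have hLN0 : 0 ≤ Real.logb 2 N0 := Real.logb_nonneg (by norm_num) hN01'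
  have h1 : C * (L / (2 * d0)) ^ (1 / (2 * n)) / 2 ^ (n * (D * d0)) ≤ (rkD k (2 * D) N0 : ℝ) / N0 := by
    refine le_trans ?_ hihN
    have e : n * (D * d0) = (n * 2 ^ ((n - 1) / 2) * ((2 * D : ℕ) : ℝ) ^ ((n - 1) / n)) *
        (2 * L / d0) ^ ((1 : ℝ) / n) := by
      rw [← hid2]
      have e1 : n + 1 - 2 = n - 1 := by ring
      have e2 : n + 1 - 1 = n := by ring
      rw [e1, e2]
      push_cast
      ring
    rw [e]
    gcongr
    norm_num
  have h2 : 1 / (2 : ℝ) ^ (D : ℝ) * (1 / 2 ^ (D * d0)) ≤ 1 / (2 : ℝ) ^ ((D : ℝ) * d) := by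
    rw [one_div_mul_one_div, ← Real.rpow_add (by norm_num)]
    apply one_div_le_one_div_of_le (by positivity)
    apply Real.rpow_le_rpow_of_exponent_le (by norm_num)
    nlinarith
  have hexp : ((n + 1) * 2 ^ ((n + 1 - 1) / 2) * (D : ℝ) ^ ((n + 1 - 1) / (n + 1))) *
        L ^ ((1 : ℝ) / (n + 1)) = D * d0 + n * (D * d0) := by
    have : D * d0 + n * (D * d0) = (n + 1) * (D * d0) := by ring
    rw [this, hid1]; ring
  rw [hexp, Real.rpow_add (by norm_num)]
  have hp : (L / (2 * d0)) ^ (1 / (2 * n)) =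
      b ^ (1 / (2 * n)) * L ^ ((1 : ℝ) / (2 * (n + 1))) := by
    rw [hid3', Real.mul_rpow hb0.le (by positivity), ← Real.rpow_mul hL0.le]
    congr 2
    rw [add_sub_cancel_right]
    field_simp
  calc _ = 1 / (17432 * 4 ^ D) * (1 / (2 : ℝ) ^ (D : ℝ) * (1 / 2 ^ (D * d0))) *
        (C * (L / (2 * d0)) ^ (1 / (2 * n)) / 2 ^ (n * (D * d0))) := by
        rw [hp]
        field_simp
    _ ≤ _ := by gcongr

lemma main_ind (k m : ℕ) : ∀ D : ℕ, 1 ≤ D → 2 ^ (m + 1) * D < k →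
    ∃ C : ℝ, 0 < C ∧ ∀ N : ℕ, 1 ≤ N → C * (Real.logb 2 N) ^ ((1 : ℝ) / (2 * ((m : ℝ) + 2))) /
      (2 : ℝ) ^ ((((m : ℝ) + 2) * 2 ^ (((m : ℝ) + 2 - 1) / 2) *
        (D : ℝ) ^ (((m : ℝ) + 2 - 1) / ((m : ℝ) + 2))) *
        (Real.logb 2 N) ^ ((1 : ℝ) / ((m : ℝ) + 2))) ≤ (rkD k D N : ℝ) / N := by
  induction m with
  | zero =>
    intro D hD hk
    have := base_case k D hD (by omega)
    simpa only [Nat.cast_zero, zero_add] using this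
  | succ m ih =>
    intro D hD hk
    have e : 2 ^ (m + 1 + 1) * D = 2 ^ (m + 1) * (2 * D) := by ring
    have h1 := ih (2 * D) (by omega) (by omega)
    have h2 : 2 * D ≤ 2 ^ (m + 1) * (2 * D) := Nat.le_mul_of_pos_left _ (by positivity)
    have := step_case k D ((m : ℝ) + 2) (by linarith [Nat.cast_nonneg (α := ℝ) m]) hD (by omega) h1
    have e2 : ((m + 1 : ℕ) : ℝ) + 2 = (m : ℝ) + 2 + 1 := by push_cast; ring
    rw [e2]
    exact this

theorem stmt0 (k : ℕ) (hk : 3 ≤ k) (n : ℤ) (hn : n = ⌈Real.logb 2 k⌉) :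
    ∃ C : ℝ, 0 < C ∧ ∀ N : ℕ, 1 ≤ N →
      (rkD k 1 N : ℝ) / N ≥
        C * (Real.logb 2 N) ^ ((1 : ℝ) / (2 * (n : ℝ))) /
          (2 : ℝ) ^ ((n : ℝ) * (2 : ℝ) ^ (((n : ℝ) - 1) / 2) *
            (Real.logb 2 N) ^ ((1 : ℝ) / (n : ℝ))) := by
  have hk0 : (0 : ℝ) < k := by
    have : (3 : ℝ) ≤ k := by exact_mod_cast hk
    linarith
  have hn2 : 2 ≤ n := by
    have : (1 : ℝ) < Real.logb 2 k := by
      rw [Real.lt_logb_iff_rpow_lt (by norm_num) hk0, Real.rpow_one]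
      exact_mod_cast hk
    have h2 : 1 < n := by
      rw [hn, Int.lt_ceil]
      exact_mod_cast this
    omega
  obtain ⟨m, rfl⟩ : ∃ m : ℕ, n = (m : ℤ) + 2 := ⟨(n - 2).toNat, by omega⟩
  have hlt : 2 ^ (m + 1) * 1 < k := by
    have h1 : (m : ℤ) + 1 < ⌈Real.logb 2 k⌉ := by omega
    rw [Int.lt_ceil, Real.lt_logb_iff_rpow_lt (by norm_num) hk0] at h1
    have e : (((m : ℤ) + 1 : ℤ) : ℝ) = ((m + 1 : ℕ) : ℝ) := by push_cast; ring
    rw [e, Real.rpow_natCast] at h1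
    rw [mul_one]
    exact_mod_cast h1
  obtain ⟨C, hC, h⟩ := main_ind k m 1 le_rfl hlt
  refine ⟨C, hC, fun N hN => ?_⟩
  have := h N hN
  rw [Nat.cast_one, Real.one_rpow, mul_one] at this
  push_cast
  exact this
end

section
/- For every ε > 0 there exists N_0 such that for all integers N ≥ N_0, r_3(N)/N ≥ (√360/(e·π^{3/2}) − ε) · (2 log N)^{1/4} / 2^{2√(2 log N)}, where e is Euler's number and log is the base-2 logarithm. -/
/-- `r3 N` is the maximum size of a subset of `[1,N] ∩ ℤ` containing no three
elements `a, b, c`, not all equal, with `a + c = 2b`. -/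
noncomputable def r3 (N : ℕ) : ℕ :=
  sSup {m | ∃ A : Finset ℕ, A ⊆ Finset.Icc 1 N ∧
    (∀ a ∈ A, ∀ b ∈ A, ∀ c ∈ A, a + c = 2 * b → a = b ∧ b = c) ∧ A.card = m}

open MeasureTheory ProbabilityTheory Filter Topology

/-- The representative in `(-1/2, 1/2]` of a point of the circle. -/
noncomputable def circRep (t : UnitAddCircle) : ℝ := (AddCircle.equivIoc (1 : ℝ) (-1/2) t : ℝ)

lemma circRep_measurable : Measurable circRep :=
  measurable_subtype_coe.comp (AddCircle.measurableEquivIoc (1 : ℝ) (-1/2)).measurable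

lemma circRep_coe (t : UnitAddCircle) : ((circRep t : ℝ) : UnitAddCircle) = t :=
  (AddCircle.equivIoc (1 : ℝ) (-1/2)).symm_apply_apply t

lemma circRep_eq {x : ℝ} (h1 : -1/2 < x) (h2 : x ≤ 1/2) : circRep (x : UnitAddCircle) = x := by
  unfold circRep
  rw [AddCircle.equivIoc_coe_eq (by constructor <;> linarith)]

lemma circRep_mp : MeasurePreserving circRep volume
    (volume.restrict (Set.Ioc (-1/2 : ℝ) (1/2))) := by
  have h := AddCircle.measurePreserving_equivIoc (T := (1:ℝ)) (a := -1/2)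
  have h2 : MeasurePreserving (Subtype.val : Set.Ioc (-1/2 : ℝ) (-1/2 + 1) → ℝ)
      (Measure.comap Subtype.val volume) (volume.restrict (Set.Ioc (-1/2 : ℝ) (-1/2+1))) :=
    measurePreserving_subtype_coe measurableSet_Ioc
  have := h2.comp h
  norm_num at this ⊢
  exact this

instance torusProb (d : ℕ) : IsProbabilityMeasure (volume : Measure (Fin d → UnitAddCircle)) := by
  have : IsProbabilityMeasure (volume : Measure UnitAddCircle) := ⟨UnitAddCircle.measure_univ⟩
  rw [volume_pi]
  infer_instance

lemma ball_bound {d : ℕ} (hd : 0 < d) {δ : ℝ} (hδ : 0 < δ) :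
    (volume : Measure (Fin d → UnitAddCircle)).real {t | ∑ i, circRep (t i) ^ 2 < δ}
      ≤ (√(2 * Real.pi * Real.exp 1 * δ / d)) ^ d := by
  have hm := circRep_measurable
  have hd' : (0:ℝ) < d := by exact_mod_cast hd
  have key := measure_le_le_exp_mul_mgf (μ := (volume : Measure (Fin d → UnitAddCircle)))
    (X := fun t => ∑ i, circRep (t i) ^ 2) δ (t := -(d / (2 * δ))) (by
      have : 0 < d / (2 * δ) := by positivity
      linarith) (by
      apply Integrable.of_bound (C := 1) (Measurable.aestronglyMeasurable (by fun_prop))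
      filter_upwards with t
      rw [Real.norm_eq_abs, abs_of_pos (Real.exp_pos _), Real.exp_le_one_iff]
      have : 0 ≤ ∑ i, circRep (t i) ^ 2 := Finset.sum_nonneg fun i _ => sq_nonneg _
      have : 0 < d / (2 * δ) := by positivity
      nlinarith)
  have hmgf : mgf (fun t : Fin d → UnitAddCircle => ∑ i, circRep (t i) ^ 2) volume
      (-(d / (2 * δ))) ≤ (√(Real.pi / (d / (2 * δ)))) ^ d := by
    unfold mgf
    simp_rw [Finset.mul_sum, Real.exp_sum]
    rw [integral_fintype_prod_volume_eq_pow
      (fun x : UnitAddCircle => Real.exp (-(d / (2 * δ)) * circRep x ^ 2)), Fintype.card_fin]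
    apply pow_le_pow_left₀ (integral_nonneg fun _ => (Real.exp_pos _).le)
    rw [← integral_gaussian]
    have h1 : ∫ x : UnitAddCircle, Real.exp (-(d / (2 * δ)) * circRep x ^ 2) =
        ∫ x in Set.Ioc (-1/2 : ℝ) (1/2), Real.exp (-(d / (2 * δ)) * x ^ 2) := by
      rw [← circRep_mp.map_eq, integral_map hm.aemeasurable
        (Measurable.aestronglyMeasurable (by fun_prop))]
    rw [h1]
    apply setIntegral_le_integral (integrable_exp_neg_mul_sq (by positivity))
    filter_upwards with x using (Real.exp_pos _).le
  calc _ ≤ (volume : Measure (Fin d → UnitAddCircle)).real {t | ∑ i, circRep (t i) ^ 2 ≤ δ} :=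
        measureReal_mono (by
          intro t ht
          exact le_of_lt (Set.mem_ofPred_eq ▸ ht))
    _ ≤ _ := key
    _ ≤ Real.exp (- -(d / (2 * δ)) * δ) * (√(Real.pi / (d / (2 * δ)))) ^ d := by gcongr
    _ = _ := by
      have e1 : Real.exp (- -(d / (2 * δ)) * δ) = (√(Real.exp 1)) ^ d := by
        rw [← Real.exp_half, ← Real.exp_nat_mul]
        congr 1
        field_simp
      rw [e1, ← mul_pow, ← Real.sqrt_mul (Real.exp_pos _).le]
      congr 2
      field_simp
      try ring

lemma exists_theta {d N : ℕ} (hd : 0 < d) (hN : 0 < N) {δ : ℝ} (hδ : 0 < δ)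
    (h : N * (√(2 * Real.pi * Real.exp 1 * δ / d)) ^ d ≤ 1) :
    ∃ θ : Fin d → UnitAddCircle, ∀ k : ℕ, 0 < k → k < N →
      δ ≤ ∑ i, circRep (k • θ i) ^ 2 := by
  by_contra hcon
  push Not at hcon
  have hm := circRep_measurable
  set B : Set (Fin d → UnitAddCircle) := {t | ∑ i, circRep (t i) ^ 2 < δ} with hB
  have hBm : MeasurableSet B := measurableSet_lt (by fun_prop) measurable_const
  have hmp : ∀ k : ℕ, 0 < k → MeasurePreserving
      (fun t : Fin d → UnitAddCircle => fun i => k • t i) volume volume := by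
    intro k hk
    have h1 : MeasurePreserving (fun t : UnitAddCircle => k • t) volume volume := by
      have := MeasureTheory.Measure.measurePreserving_zsmul (volume : Measure UnitAddCircle) (n := (k:ℤ)) (by omega)
      simpa using this
    exact measurePreserving_pi _ _ (fun _ => h1)
  have hcov : (Set.univ : Set (Fin d → UnitAddCircle)) ⊆
      ⋃ k ∈ Finset.Ico 1 N, (fun t : Fin d → UnitAddCircle => fun i => k • t i) ⁻¹' B := by
    intro θ _
    obtain ⟨k, h1, h2, h3⟩ := hcon θ
    simp only [Set.mem_iUnion]
    exact ⟨k, by simp; omega, h3⟩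
  have h1 : (1:ℝ) ≤ ∑ k ∈ Finset.Ico 1 N, (volume : Measure (Fin d → UnitAddCircle)).real
      ((fun t : Fin d → UnitAddCircle => fun i => k • t i) ⁻¹' B) := by
    calc (1:ℝ) = (volume : Measure (Fin d → UnitAddCircle)).real Set.univ := by simp
      _ ≤ _ := measureReal_mono hcov (measure_ne_top _ _)
      _ ≤ _ := measureReal_biUnion_finset_le _ _
  have h2 : ∀ k ∈ Finset.Ico 1 N, (volume : Measure (Fin d → UnitAddCircle)).real
      ((fun t : Fin d → UnitAddCircle => fun i => k • t i) ⁻¹' B) ≤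
        (√(2 * Real.pi * Real.exp 1 * δ / d)) ^ d := by
    intro k hk
    rw [Finset.mem_Ico] at hk
    rw [(hmp k (by omega)).measureReal_preimage hBm.nullMeasurableSet]
    exact ball_bound hd hδ
  have h3 := h1.trans (Finset.sum_le_sum h2)
  rw [Finset.sum_const, Nat.card_Ico, nsmul_eq_mul, Nat.cast_sub (by omega)] at h3
  have : 0 < (√(2 * Real.pi * Real.exp 1 * δ / d)) ^ d := by positivity
  push_cast at h3
  nlinarith

/-- The spherical shell on the torus. -/
def shell (d : ℕ) (r δ : ℝ) : Set (Fin d → UnitAddCircle) :=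
  {t | (∀ i, circRep (t i) ∈ Set.Ioc (-1/4 : ℝ) (1/4)) ∧
    ∑ i, circRep (t i) ^ 2 ∈ Set.Ioc (r - δ) r}

lemma shell_measurable (d : ℕ) (r δ : ℝ) : MeasurableSet (shell d r δ) := by
  have hm := circRep_measurable
  apply MeasurableSet.inter
  · have : {t : Fin d → UnitAddCircle | ∀ i, circRep (t i) ∈ Set.Ioc (-1/4 : ℝ) (1/4)} =
      ⋂ i, (fun t => circRep (t i)) ⁻¹' Set.Ioc (-1/4 : ℝ) (1/4) := by ext; simp
    change MeasurableSet {t : Fin d → UnitAddCircle | ∀ i, circRep (t i) ∈ Set.Ioc (-1/4 : ℝ) (1/4)}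
    rw [this]
    exact MeasurableSet.iInter fun i => measurableSet_Ioc.preimage (by fun_prop)
  · change MeasurableSet ((fun t : Fin d → UnitAddCircle => ∑ i, circRep (t i) ^ 2) ⁻¹'
      Set.Ioc (r - δ) r)
    exact measurableSet_Ioc.preimage (by fun_prop)

/-- Half of the 3-AP argument: if `b < c`, contradiction. -/
lemma shell_ap {d N : ℕ} {r δ : ℝ} {θ α : Fin d → UnitAddCircle}
    (hθ : ∀ k : ℕ, 0 < k → k < N → δ ≤ ∑ i, circRep (k • θ i) ^ 2)
    {a b c : ℕ} (hc : c ≤ N) (hb1 : 1 ≤ b) (habc : a + c = 2 * b) (hbc : b < c)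
    (ha : (fun i => a • θ i + α i) ∈ shell d r δ)
    (hb : (fun i => b • θ i + α i) ∈ shell d r δ)
    (hcc : (fun i => c • θ i + α i) ∈ shell d r δ) : False := by
  obtain ⟨ha1, ha2⟩ := ha
  obtain ⟨hb1', hb2⟩ := hb
  obtain ⟨hc1, hc2⟩ := hcc
  simp only at ha1 ha2 hb1' hb2 hc1 hc2
  set x := fun i => circRep (a • θ i + α i) with hx
  set y := fun i => circRep (b • θ i + α i) with hy
  set z := fun i => circRep (c • θ i + α i) with hz
  have hx' : ∀ i, ((x i : ℝ) : UnitAddCircle) = a • θ i + α i := fun i => circRep_coe _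
  have hy' : ∀ i, ((y i : ℝ) : UnitAddCircle) = b • θ i + α i := fun i => circRep_coe _
  have hz' : ∀ i, ((z i : ℝ) : UnitAddCircle) = c • θ i + α i := fun i => circRep_coe _
  have hlin : ∀ i, x i + z i = 2 * y i := by
    intro i
    have h0 : ((x i + z i - 2 * y i : ℝ) : UnitAddCircle) = 0 := by
      have : x i + z i - 2 * y i = x i + z i - (y i + y i) := by ring
      rw [this, AddCircle.coe_sub, AddCircle.coe_add, AddCircle.coe_add, hx', hy', hz']
      have e : (a • θ i + c • θ i) = b • θ i + b • θ i := by
        rw [← add_smul, ← add_smul, habc, two_mul]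
      calc _ = (a • θ i + c • θ i) - (b • θ i + b • θ i) := by abel
        _ = 0 := by rw [e, sub_self]
    rw [AddCircle.coe_eq_zero_iff] at h0
    obtain ⟨n, hn⟩ := h0
    rw [zsmul_eq_mul, mul_one] at hn
    have h1 := ha1 i; have h2 := hb1' i; have h3 := hc1 i
    change x i ∈ _ at h1; change y i ∈ _ at h2; change z i ∈ _ at h3
    have u1 : (n:ℝ) < 1 := by rw [hn]; linarith [h1.1, h1.2, h2.1, h2.2, h3.1, h3.2]
    have u2 : (-1:ℝ) < n := by rw [hn]; linarith [h1.1, h1.2, h2.1, h2.2, h3.1, h3.2]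
    have : n = 0 := by
      have : n < 1 := by exact_mod_cast u1
      have : -1 < n := by exact_mod_cast u2
      omega
    rw [this] at hn
    push_cast at hn
    linarith
  have hu : ∀ i, circRep ((c - b) • θ i) = z i - y i := by
    intro i
    have : (c - b) • θ i = ((z i - y i : ℝ) : UnitAddCircle) := by
      rw [AddCircle.coe_sub, hz', hy', sub_nsmul _ hbc.le]
      abel
    rw [this]
    have h2 := hb1' i; have h3 := hc1 i
    change y i ∈ _ at h2; change z i ∈ _ at h3
    exact circRep_eq (by linarith [h2.1, h2.2, h3.1, h3.2]) (by linarith [h2.1, h2.2, h3.1, h3.2])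
  have h1 := hθ (c - b) (by omega) (by omega)
  simp_rw [hu] at h1
  have h2 : ∑ i, (z i - y i) ^ 2 = (∑ i, x i ^ 2 + ∑ i, z i ^ 2) / 2 - ∑ i, y i ^ 2 := by
    rw [← Finset.sum_add_distrib, Finset.sum_div, ← Finset.sum_sub_distrib]
    refine Finset.sum_congr rfl fun i _ => ?_
    have : x i = 2 * y i - z i := by linarith [hlin i]
    rw [this]; ring
  have h3 : ∑ i, x i ^ 2 ≤ r := ha2.2
  have h4 : r - δ < ∑ i, y i ^ 2 := hb2.1
  have h5 : ∑ i, z i ^ 2 ≤ r := hc2.2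
  linarith

lemma r3_ge {N : ℕ} (A : Finset ℕ) (hA : A ⊆ Finset.Icc 1 N)
    (h : ∀ a ∈ A, ∀ b ∈ A, ∀ c ∈ A, a + c = 2 * b → a = b ∧ b = c) : A.card ≤ r3 N := by
  apply le_csSup
  · refine ⟨N, ?_⟩
    rintro m ⟨B, hB, -, rfl⟩
    simpa using Finset.card_le_card hB
  · exact ⟨A, hA, h, rfl⟩

lemma r3_ge_shell {d N : ℕ} (hd : 0 < d) (hN : 0 < N) {δ : ℝ} (hδ : 0 < δ) (r : ℝ)
    (h : N * (√(2 * Real.pi * Real.exp 1 * δ / d)) ^ d ≤ 1) :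
    N * (volume : Measure (Fin d → UnitAddCircle)).real (shell d r δ) ≤ r3 N := by
  classical
  obtain ⟨θ, hθ⟩ := exists_theta hd hN hδ h
  have hS := shell_measurable d r δ
  let T : ℕ → (Fin d → UnitAddCircle) → (Fin d → UnitAddCircle) := fun n α i => n • θ i + α i
  have hT : ∀ n, MeasurePreserving (T n) volume volume := fun n =>
    measurePreserving_add_left volume (fun i => n • θ i)
  let A : (Fin d → UnitAddCircle) → Finset ℕ := fun α =>
    (Finset.Icc 1 N).filter (fun n => T n α ∈ shell d r δ)
  have hA : ∀ α, (A α).card ≤ r3 N := by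
    intro α
    apply r3_ge _ (Finset.filter_subset _ _)
    intro a ha b hb c hc habc
    simp only [A, Finset.mem_filter, Finset.mem_Icc] at ha hb hc
    rcases lt_trichotomy b c with hlt | heq | hgt
    · exact (shell_ap hθ hc.1.2 hb.1.1 habc hlt ha.2 hb.2 hc.2).elim
    · omega
    · exact (shell_ap hθ ha.1.2 hb.1.1 (by omega) (by omega) hc.2 hb.2 ha.2).elim
  have hint : ∫ α, ((A α).card : ℝ) = N * (volume : Measure (Fin d → UnitAddCircle)).real (shell d r δ) := by
    have e : ∀ α, ((A α).card : ℝ) = ∑ n ∈ Finset.Icc 1 N,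
        (T n ⁻¹' shell d r δ).indicator (fun _ => (1:ℝ)) α := by
      intro α
      simp only [A, Finset.card_filter, Set.indicator, Set.mem_preimage]
      push_cast
      rfl
    simp_rw [e]
    rw [integral_finsetSum]
    · have : ∀ n ∈ Finset.Icc 1 N, ∫ α, (T n ⁻¹' shell d r δ).indicator (fun _ => (1:ℝ)) α =
          (volume : Measure (Fin d → UnitAddCircle)).real (shell d r δ) := by
        intro n _
        rw [integral_indicator_const _ ((hT n).measurable hS),
          (hT n).measureReal_preimage hS.nullMeasurableSet]
        simp
      rw [Finset.sum_congr rfl this]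
      simp
    · intro n _
      exact (integrable_const _).indicator ((hT n).measurable hS)
  rw [← hint]
  calc ∫ α, ((A α).card : ℝ) ≤ ∫ α : Fin d → UnitAddCircle, (r3 N : ℝ) := by
        apply integral_mono_of_nonneg
        · filter_upwards with α using Nat.cast_nonneg _
        · exact integrable_const _
        · filter_upwards with α using (by exact_mod_cast hA α)
    _ = _ := by simp

/-- Uniform probability measure on `(-1/4, 1/4]`. -/
noncomputable def nu : Measure ℝ := (2 : ENNReal) • volume.restrict (Set.Ioc (-1/4 : ℝ) (1/4))

instance : IsProbabilityMeasure nu := ⟨by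
  unfold nu
  rw [Measure.smul_apply, Measure.restrict_apply_univ, Real.volume_Ioc, smul_eq_mul]
  rw [show (2:ENNReal) = ENNReal.ofReal 2 by simp, ← ENNReal.ofReal_mul (by norm_num)]
  norm_num⟩

lemma pi_nu (d : ℕ) : Measure.pi (fun _ : Fin d => nu) =
    (2 : ENNReal) ^ d • (Measure.pi (fun _ : Fin d => (volume : Measure ℝ))).restrict
      (Set.univ.pi fun _ => Set.Ioc (-1/4 : ℝ) (1/4)) := by
  rw [Measure.restrict_pi_pi]
  apply Measure.pi_eq
  intro s hs
  rw [Measure.smul_apply, Measure.pi_pi, smul_eq_mul]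
  simp only [nu, Measure.smul_apply, smul_eq_mul]
  rw [Finset.prod_mul_distrib]
  simp

lemma vol_shell (d : ℕ) (r δ : ℝ) : (volume : Measure (Fin d → UnitAddCircle)).real (shell d r δ) =
    (1/2) ^ d * (Measure.pi (fun _ : Fin d => nu)).real {x | ∑ i, x i ^ 2 ∈ Set.Ioc (r - δ) r} := by
  have hmeas : MeasurableSet {x : Fin d → ℝ | ∑ i, x i ^ 2 ∈ Set.Ioc (r - δ) r} :=
    measurableSet_Ioc.preimage (f := fun x : Fin d → ℝ => ∑ i, x i ^ 2) (by fun_prop)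
  have hbox : MeasurableSet (Set.univ.pi fun _ : Fin d => Set.Ioc (-1/4 : ℝ) (1/4)) :=
    MeasurableSet.univ_pi fun _ => measurableSet_Ioc
  have hmp : MeasurePreserving (fun (t : Fin d → UnitAddCircle) i => circRep (t i)) volume
      (Measure.pi fun _ => volume.restrict (Set.Ioc (-1/2 : ℝ) (1/2))) :=
    measurePreserving_pi _ _ (fun _ => circRep_mp)
  have hpre : shell d r δ = (fun (t : Fin d → UnitAddCircle) i => circRep (t i)) ⁻¹'
      ({x : Fin d → ℝ | ∑ i, x i ^ 2 ∈ Set.Ioc (r - δ) r} ∩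
        (Set.univ.pi fun _ : Fin d => Set.Ioc (-1/4 : ℝ) (1/4))) := by
    ext t
    simp only [shell, Set.mem_ofPred_eq, Set.mem_preimage, Set.mem_inter_iff, Set.mem_pi,
      Set.mem_univ, forall_true_left]
    tauto
  rw [hpre, hmp.measureReal_preimage (hmeas.inter hbox).nullMeasurableSet, pi_nu,
    ← Measure.restrict_pi_pi, measureReal_restrict_apply (hmeas.inter hbox),
    measureReal_ennreal_smul_apply, measureReal_restrict_apply hmeas]
  have : ({x : Fin d → ℝ | ∑ i, x i ^ 2 ∈ Set.Ioc (r - δ) r} ∩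
        (Set.univ.pi fun _ : Fin d => Set.Ioc (-1/4 : ℝ) (1/4))) ∩
        (Set.univ.pi fun _ : Fin d => Set.Ioc (-1/2 : ℝ) (1/2)) =
      {x : Fin d → ℝ | ∑ i, x i ^ 2 ∈ Set.Ioc (r - δ) r} ∩
        (Set.univ.pi fun _ : Fin d => Set.Ioc (-1/4 : ℝ) (1/4)) := by
    apply Set.inter_eq_left.mpr
    rintro x ⟨-, hx⟩ i hi
    have := hx i hi
    exact ⟨by linarith [this.1], by linarith [this.2]⟩
  rw [this, ENNReal.toReal_pow, ← mul_assoc, ← mul_pow]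
  simp

lemma nu_integral_pow (k : ℕ) : ∫ x, x ^ k ∂nu =
    2 * (((1/4 : ℝ) ^ (k+1) - (-1/4) ^ (k+1)) / (k+1)) := by
  unfold nu
  rw [integral_smul_measure, ← intervalIntegral.integral_of_le (by norm_num), integral_pow]
  simp

lemma nu_ae_bound : ∀ᵐ x ∂nu, x ∈ Set.Ioc (-1/4 : ℝ) (1/4) := by
  unfold nu
  exact Measure.ae_smul_measure (ae_restrict_mem measurableSet_Ioc) _

/-- CLT for the squared norm. -/
lemma clt_nu (η : ℝ) (hη : 0 < η) : Tendsto (fun d : ℕ => (Measure.pi (fun _ : Fin d => nu)).real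
    {x | ∑ i, x i ^ 2 ∈ Set.Ioc ((d:ℝ) / 48 - η * √(d / 2880)) (d / 48 + η * √(d / 2880))})
    atTop (𝓝 ((gaussianReal 0 1).real (Set.Ioc (-η) η))) := by
  let P : Measure (ℕ → ℝ) := Measure.infinitePi (fun _ => nu)
  let X : ℕ → (ℕ → ℝ) → ℝ := fun k ω => ω k ^ 2
  have hXm : ∀ k, Measurable (X k) := fun k => by fun_prop
  have hev : ∀ k, MeasurePreserving (fun ω : ℕ → ℝ => ω k) P nu := fun k =>
    measurePreserving_eval_infinitePi (fun _ => nu) k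
  have hindep : iIndepFun X P :=
    iIndepFun_infinitePi (X := fun _ (x : ℝ) => x ^ 2) (fun _ => by fun_prop)
  have hident : ∀ i, IdentDistrib (X i) (X 0) P P := by
    intro i
    have : IdentDistrib (fun ω : ℕ → ℝ => ω i) (fun ω => ω 0) P P :=
      ⟨(hev i).measurable.aemeasurable, (hev 0).measurable.aemeasurable, by
        rw [(hev i).map_eq, (hev 0).map_eq]⟩
    exact this.comp (u := fun x => x ^ 2) (by fun_prop)
  have hmean : P[X 0] = 1/48 := by
    have : ∫ ω, X 0 ω ∂P = ∫ x, x ^ 2 ∂nu := by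
      rw [← (hev 0).map_eq, integral_map (hev 0).measurable.aemeasurable
        (Measurable.aestronglyMeasurable (by fun_prop))]
    rw [this, nu_integral_pow]; norm_num
  have hLp : MemLp (X 0) 2 P := by
    apply MemLp.of_bound (hXm 0).aestronglyMeasurable 1
    filter_upwards [(hev 0).quasiMeasurePreserving.ae nu_ae_bound] with ω hω
    simp only [X, Real.norm_eq_abs]
    rw [abs_of_nonneg (sq_nonneg (ω 0))]
    nlinarith [hω.1, hω.2]
  have hvar : Var[X 0; P] = 1/2880 := by
    rw [variance_eq_sub hLp, hmean]
    have : ∫ ω, (X 0 ^ 2) ω ∂P = ∫ x, x ^ 4 ∂nu := by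
      rw [← (hev 0).map_eq, integral_map (hev 0).measurable.aemeasurable
        (Measurable.aestronglyMeasurable (by fun_prop))]
      congr 1
      ext ω
      simp only [X, Pi.pow_apply]; ring
    rw [this, nu_integral_pow]; norm_num
  have hs0 : 0 < √(1 / 2880 : ℝ) := by positivity
  have hlaw : HasLaw (fun x : ℝ => √(1 / 2880 : ℝ) * x)
      (gaussianReal 0 Var[X 0; P].toNNReal) (gaussianReal 0 1) := by
    refine ⟨by fun_prop, ?_⟩
    rw [gaussianReal_map_const_mul, hvar]
    congr 1
    · simp
    · ext
      simp
  have hclt := tendstoInDistribution_inv_sqrt_mul_sum_sub (P := P) (X := X)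
    (P' := gaussianReal 0 1) hlaw hLp hindep hident
  have h1 := ProbabilityMeasure.tendsto_measure_of_null_frontier_of_tendsto' hclt.tendsto
    (E := Set.Ioc (-(√(1 / 2880 : ℝ) * η)) (√(1 / 2880 : ℝ) * η)) (by
      have hv : Var[X 0; P].toNNReal ≠ 0 := by
        rw [hvar]; simp
      have : NullSingletonClass (gaussianReal 0 Var[X 0; P].toNNReal) := nullSingletonClass_gaussianReal hv
      have hpos : 0 < √(1 / 2880 : ℝ) * η := by positivity
      rw [frontier_Ioc (by linarith)]
      simp only [ProbabilityMeasure.coe_mk]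
      rw [hlaw.map_eq]
      exact (Set.toFinite _).measure_zero _)
  simp only [ProbabilityMeasure.coe_mk] at h1
  rw [Measure.map_apply (by fun_prop) measurableSet_Ioc] at h1
  have hset : (fun x : ℝ => √(1 / 2880 : ℝ) * x) ⁻¹'
      Set.Ioc (-(√(1 / 2880 : ℝ) * η)) (√(1 / 2880 : ℝ) * η) = Set.Ioc (-η) η := by
    ext x
    simp only [Set.mem_preimage, Set.mem_Ioc]
    rw [← mul_neg, mul_lt_mul_iff_right₀ hs0, mul_le_mul_iff_right₀ hs0]
  rw [hset] at h1
  have h2 := (ENNReal.tendsto_toReal (measure_ne_top _ _)).comp h1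
  refine h2.congr' ?_
  filter_upwards [eventually_gt_atTop 0] with d hd
  have hd' : (0:ℝ) < d := by exact_mod_cast hd
  simp only [Function.comp_apply]
  rw [hmean, Measure.map_apply (by fun_prop) measurableSet_Ioc]
  have hmap : Measure.pi (fun _ : Fin d => nu) = P.map (fun ω (i : Fin d) => ω i) := by
    rw [← Measure.infinitePi_eq_pi]
    exact (Measure.map_infinitePi_infinitePi_of_inj (P := fun _ : ℕ => nu)
      (f := fun i : Fin d => (i : ℕ)) Fin.val_injective).symm
  have hmeas : MeasurableSet {x : Fin d → ℝ | ∑ i, x i ^ 2 ∈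
      Set.Ioc ((d:ℝ) / 48 - η * √(d / 2880)) (d / 48 + η * √(d / 2880))} :=
    measurableSet_Ioc.preimage (f := fun x : Fin d → ℝ => ∑ i, x i ^ 2) (by fun_prop)
  rw [hmap, Measure.real, Measure.map_apply (by fun_prop) hmeas]
  congr 2
  ext ω
  have hs : 0 < √(d:ℝ) := by positivity
  have hsd : √((d:ℝ) / 2880) = √(1 / 2880 : ℝ) * √d := by
    rw [← Real.sqrt_mul (by norm_num)]
    congr 1
    ring
  simp only [Set.mem_preimage, Set.mem_Ioc, Set.mem_ofPred_eq, X,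
    Fin.sum_univ_eq_sum_range (fun i => ω i ^ 2) d]
  rw [hsd, inv_mul_eq_div, lt_div_iff₀ hs, div_le_iff₀ hs]
  constructor <;> rintro ⟨h1, h2⟩ <;> constructor <;> linarith

lemma gauss_lower (η : ℝ) (hη : 0 < η) :
    2 * η * (Real.exp (-η ^ 2 / 2) / √(2 * Real.pi)) ≤ (gaussianReal 0 1).real (Set.Ioc (-η) η) := by
  rw [Measure.real, gaussianReal_apply_eq_integral _ one_ne_zero, ENNReal.toReal_ofReal
    (integral_nonneg fun _ => gaussianPDFReal_nonneg _ _ _)]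
  calc 2 * η * (Real.exp (-η ^ 2 / 2) / √(2 * Real.pi))
      = ∫ x in Set.Ioc (-η) η, (Real.exp (-η ^ 2 / 2) / √(2 * Real.pi)) := by
        rw [setIntegral_const, Measure.real, Real.volume_Ioc, ENNReal.toReal_ofReal (by linarith),
          smul_eq_mul]
        ring
    _ ≤ _ := by
      apply setIntegral_mono_on (by simp) (integrable_gaussianPDFReal 0 1).integrableOn measurableSet_Ioc
      intro x hx
      rw [gaussianPDFReal]
      simp only [NNReal.coe_one, mul_one, sub_zero]
      rw [div_eq_inv_mul]
      refine mul_le_mul_of_nonneg_left (Real.exp_le_exp.mpr ?_) (by positivity)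
      nlinarith [hx.1, hx.2]

lemma pigeon (d : ℕ) (c L δ : ℝ) (hL : 0 < L) (hδ : 0 < δ) : ∃ r : ℝ,
    δ / (2 * L + δ) * (Measure.pi (fun _ : Fin d => nu)).real
      {x | ∑ i, x i ^ 2 ∈ Set.Ioc (c - L) (c + L)} ≤
    (Measure.pi (fun _ : Fin d => nu)).real {x | ∑ i, x i ^ 2 ∈ Set.Ioc (r - δ) r} := by
  by_contra hcon
  push Not at hcon
  set p := (Measure.pi (fun _ : Fin d => nu)).real
      {x | ∑ i, x i ^ 2 ∈ Set.Ioc (c - L) (c + L)} with hp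
  set M := ⌈2 * L / δ⌉₊ with hM
  have hMpos : 0 < M := Nat.ceil_pos.mpr (by positivity)
  have hM1 : (M:ℝ) < 2 * L / δ + 1 := Nat.ceil_lt_add_one (by positivity)
  have hM2 : 2 * L / δ ≤ M := Nat.le_ceil _
  have hcov : {x : Fin d → ℝ | ∑ i, x i ^ 2 ∈ Set.Ioc (c - L) (c + L)} ⊆
      ⋃ k ∈ Finset.range M, {x : Fin d → ℝ | ∑ i, x i ^ 2 ∈
        Set.Ioc ((c - L + (k + 1) * δ) - δ) (c - L + (k + 1) * δ)} := by
    intro x hx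
    simp only [Set.mem_ofPred_eq, Set.mem_Ioc] at hx
    set s := ∑ i, x i ^ 2
    have hpos : 0 < (s - (c - L)) / δ := div_pos (by linarith) hδ
    have hc0 : 0 < ⌈(s - (c - L)) / δ⌉₊ := Nat.ceil_pos.mpr hpos
    obtain ⟨k, hk⟩ : ∃ k, ⌈(s - (c - L)) / δ⌉₊ = k + 1 := ⟨_, (Nat.succ_pred_eq_of_pos hc0).symm⟩
    have h1 := Nat.le_ceil ((s - (c - L)) / δ)
    have h2 := Nat.ceil_lt_add_one hpos.le
    rw [hk] at h1 h2
    push_cast at h1 h2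
    rw [div_le_iff₀ hδ] at h1
    have h2' : (k:ℝ) < (s - (c - L)) / δ := by linarith
    rw [lt_div_iff₀ hδ] at h2'
    simp only [Set.mem_iUnion]
    refine ⟨k, ?_, ?_⟩
    · rw [Finset.mem_range]
      have : k + 1 ≤ M := by
        rw [← hk, hM]
        apply Nat.ceil_mono
        gcongr
        linarith
      omega
    · change s ∈ Set.Ioc _ _
      constructor <;> linarith
  have h1 : p ≤ ∑ k ∈ Finset.range M, (Measure.pi (fun _ : Fin d => nu)).real
      {x : Fin d → ℝ | ∑ i, x i ^ 2 ∈
        Set.Ioc ((c - L + (k + 1) * δ) - δ) (c - L + (k + 1) * δ)} :=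
    (measureReal_mono hcov (measure_ne_top _ _)).trans (measureReal_biUnion_finset_le _ _)
  have h2 : p < ∑ k ∈ Finset.range M, δ / (2 * L + δ) * p := by
    refine h1.trans_lt ?_
    apply Finset.sum_lt_sum_of_nonempty (by simpa using hMpos.ne')
    intro k _
    exact hcon _
  rw [Finset.sum_const, Finset.card_range, nsmul_eq_mul] at h2
  have hp0 : 0 ≤ p := measureReal_nonneg
  have h3 : (M:ℝ) * (δ / (2 * L + δ)) ≤ 1 := by
    rw [mul_div_assoc', div_le_one (by positivity)]
    have := mul_le_mul_of_nonneg_right hM1.le hδ.le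
    calc _ ≤ _ := this
      _ = _ := by field_simp
  nlinarith

/-- Probability that the squared norm is within `η` standard deviations of its mean. -/
noncomputable def centralProb (η : ℝ) (d : ℕ) : ℝ := (Measure.pi (fun _ : Fin d => nu)).real
    {x | ∑ i, x i ^ 2 ∈ Set.Ioc ((d:ℝ) / 48 - η * √(d / 2880)) (d / 48 + η * √(d / 2880))}

/-- The constant obtained in dimension `d`. -/
noncomputable def constC (η : ℝ) (d : ℕ) : ℝ :=
  (2:ℝ) ^ (-(1 / (d:ℝ))) * (centralProb η d / (2 * Real.pi * Real.exp 1)) /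
    (2 * η * √(1/2880) + √d * 2 ^ (2 - (d:ℝ)))

lemma sqrt_mul_two_pow_tendsto :
    Tendsto (fun d : ℕ => √(d:ℝ) * 2 ^ (2 - (d:ℝ))) atTop (𝓝 0) := by
  have h := tendsto_pow_const_mul_const_pow_of_lt_one 1 (r := (1/2 : ℝ)) (by norm_num) (by norm_num)
  have h4 := h.const_mul 4
  rw [mul_zero] at h4
  refine squeeze_zero' (Eventually.of_forall fun d => by positivity) ?_ h4
  filter_upwards [eventually_ge_atTop 1] with d hd
  have hd' : (1:ℝ) ≤ d := by exact_mod_cast hd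
  have h1 : (2:ℝ) ^ (2 - (d:ℝ)) = 4 * (1/2)^d := by
    rw [Real.rpow_sub (by norm_num), Real.rpow_natCast, one_div, inv_pow]
    norm_num
    rfl
  rw [h1]
  have h2 : √(d:ℝ) ≤ d := by
    rw [Real.sqrt_le_left (by linarith)]
    nlinarith
  have : (0:ℝ) < (1/2)^d := by positivity
  nlinarith

lemma constC_tendsto (η : ℝ) (hη : 0 < η) : Tendsto (constC η) atTop
    (𝓝 (((gaussianReal 0 1).real (Set.Ioc (-η) η)) / (2 * Real.pi * Real.exp 1) /
      (2 * η * √(1/2880)))) := by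
  have h1 : Tendsto (fun d : ℕ => (2:ℝ) ^ (-(1 / (d:ℝ)))) atTop (𝓝 1) := by
    have : Tendsto (fun d : ℕ => -(1 / (d:ℝ))) atTop (𝓝 0) := by
      simpa using (tendsto_one_div_atTop_nhds_zero_nat (𝕜 := ℝ)).neg
    have h0 := ((Real.continuous_const_rpow (a := (2:ℝ)) (by norm_num)).tendsto 0).comp this
    rw [Real.rpow_zero] at h0
    exact h0
  have h2 : Tendsto (centralProb η) atTop (𝓝 ((gaussianReal 0 1).real (Set.Ioc (-η) η))) :=
    clt_nu η hη
  have h3 := ((h1.mul (h2.div_const (2 * Real.pi * Real.exp 1))).div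
    (sqrt_mul_two_pow_tendsto.const_add (2 * η * √(1/2880))) (by positivity))
  rw [one_mul, add_zero] at h3
  exact h3

lemma main_ineq (η : ℝ) (hη : 0 < η) (N : ℕ) (hN : 2 ≤ N) (D : ℝ)
    (hD : D = √(2 * Real.logb 2 N)) (d : ℕ) (hd : d = ⌈D⌉₊) :
    constC η d * √D / 2 ^ (2 * D) ≤ r3 N / N := by
  have hN' : (2:ℝ) ≤ N := by exact_mod_cast hN
  have hN0 : (0:ℝ) < N := by linarith
  have hlog : 0 < Real.logb 2 N := Real.logb_pos (by norm_num) (by linarith)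
  have hDpos : 0 < D := by rw [hD]; positivity
  have hD2 : D ^ 2 = 2 * Real.logb 2 N := by rw [hD, Real.sq_sqrt (by positivity)]
  have hNpow : (N:ℝ) = 2 ^ (D ^ 2 / 2) := by
    rw [hD2, mul_div_cancel_left₀ _ (by norm_num), Real.rpow_logb (by norm_num) (by norm_num) hN0]
  have hdpos : 0 < d := by rw [hd]; exact Nat.ceil_pos.mpr hDpos
  have hd0 : (0:ℝ) < d := by exact_mod_cast hdpos
  have hd1 : D ≤ d := by rw [hd]; exact Nat.le_ceil _
  have hd2 : (d:ℝ) < D + 1 := by rw [hd]; exact Nat.ceil_lt_add_one hDpos.le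
  set q : ℝ := 2 ^ (-(D ^ 2 / d)) with hq
  have hq0 : 0 < q := by positivity
  set δ : ℝ := d / (2 * Real.pi * Real.exp 1) * q with hδ
  have hδ0 : 0 < δ := by positivity
  have hqd : N * (√(2 * Real.pi * Real.exp 1 * δ / d)) ^ d ≤ 1 := by
    have : 2 * Real.pi * Real.exp 1 * δ / d = q := by
      rw [hδ]; field_simp
    rw [this, hq, Real.sqrt_eq_rpow, ← Real.rpow_mul (by norm_num), ← Real.rpow_natCast,
      ← Real.rpow_mul (by norm_num), hNpow, ← Real.rpow_add (by norm_num)]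
    have : D ^ 2 / 2 + -(D ^ 2 / d) * (1 / 2) * d = 0 := by field_simp; ring
    rw [this, Real.rpow_zero]
  obtain ⟨r, hr⟩ := pigeon d (d / 48) (η * √(d / 2880)) δ (by positivity) hδ0
  change δ / (2 * (η * √(d / 2880)) + δ) * centralProb η d ≤ _ at hr
  have hmain := r3_ge_shell hdpos (by omega) hδ0 r hqd
  rw [vol_shell] at hmain
  rw [le_div_iff₀ hN0]
  refine le_trans ?_ hmain
  rw [mul_comm]
  refine mul_le_mul_of_nonneg_left ?_ hN0.le
  refine le_trans ?_ (mul_le_mul_of_nonneg_left hr (by positivity))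
  have hP : 0 ≤ centralProb η d := measureReal_nonneg
  have hsd : √((d:ℝ) / 2880) = √(1 / 2880 : ℝ) * √d := by
    rw [← Real.sqrt_mul (by norm_num)]
    congr 1
    ring
  have hsdd : √(d:ℝ) * √d = d := Real.mul_self_sqrt hd0.le
  have hsd0 : 0 < √(d:ℝ) := by positivity
  set w : ℝ := √(1/2880) with hw
  have hw0 : 0 < w := by positivity
  set E : ℝ := 2 * Real.pi * Real.exp 1 with hE
  have hE1 : 1 ≤ E := by
    have := Real.pi_gt_three
    have := Real.add_one_le_exp 1
    nlinarith
  have hfrac : δ / (2 * (η * √(d / 2880)) + δ) = √d * q / E / (2 * η * w + √d * q / E) := by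
    have e1 : δ = √d * (√d * q / E) := by
      rw [hδ, mul_div_assoc', ← mul_assoc, hsdd]; ring
    have e2 : 2 * (η * √(d / 2880)) + δ = √d * (2 * η * w + √d * q / E) := by
      rw [e1, hsd]; ring
    rw [e2, e1, mul_div_mul_left _ _ hsd0.ne']
  rw [hfrac]
  have hqle : q ≤ 2 ^ (2 - (d:ℝ)) := by
    rw [hq]
    apply Real.rpow_le_rpow_of_exponent_le (by norm_num)
    rw [neg_le, le_div_iff₀ hd0]
    nlinarith
  have hκ : √d * q / E ≤ √d * 2 ^ (2 - (d:ℝ)) := by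
    rw [div_le_iff₀ (by linarith)]
    have : √d * q ≤ √d * 2 ^ (2 - (d:ℝ)) := by gcongr
    have : 0 ≤ √(d:ℝ) * 2 ^ (2 - (d:ℝ)) := by positivity
    nlinarith
  have hpow : (2:ℝ) ^ (-(1 / (d:ℝ))) / 2 ^ (2 * D) ≤ (1/2) ^ d * q := by
    have : ((1:ℝ)/2) ^ d = 2 ^ (-(d:ℝ)) := by
      rw [Real.rpow_neg (by norm_num), Real.rpow_natCast, one_div, inv_pow]
    rw [this, hq, ← Real.rpow_sub (by norm_num), ← Real.rpow_add (by norm_num)]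
    apply Real.rpow_le_rpow_of_exponent_le (by norm_num)
    have : (d + D ^ 2 / d - 2 * D) ≤ 1 / d := by
      have : d + D ^ 2 / d - 2 * D = (d - D) ^ 2 / d := by field_simp; ring
      rw [this]
      gcongr
      nlinarith
    linarith
  have hsqrt : √D ≤ √d := Real.sqrt_le_sqrt hd1
  calc constC η d * √D / 2 ^ (2 * D)
      = ((2:ℝ) ^ (-(1 / (d:ℝ))) / 2 ^ (2 * D)) * √D *
          (centralProb η d / E / (2 * η * w + √d * 2 ^ (2 - (d:ℝ)))) := by
        rw [constC]; ring
    _ ≤ ((1/2) ^ d * q) * √d * (centralProb η d / E / (2 * η * w + √d * q / E)) := by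
        gcongr
    _ = _ := by ring

theorem stmt1 (ε : ℝ) (hε : 0 < ε) :
    ∃ N₀ : ℕ, ∀ N : ℕ, N₀ ≤ N →
      (r3 N : ℝ) / N ≥
        (Real.sqrt 360 / (Real.exp 1 * Real.pi ^ ((3 : ℝ) / 2)) - ε) *
          (2 * Real.logb 2 N) ^ ((1 : ℝ) / 4) /
            (2 : ℝ) ^ (2 * Real.sqrt (2 * Real.logb 2 N)) := by
  set K : ℝ := Real.sqrt 360 / (Real.exp 1 * Real.pi ^ ((3 : ℝ) / 2)) with hK
  obtain ⟨η, hη, hKη⟩ : ∃ η : ℝ, 0 < η ∧ K - ε < K * Real.exp (-η ^ 2 / 2) := by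
    have hc : Tendsto (fun η : ℝ => K * Real.exp (-η ^ 2 / 2)) (𝓝[>] 0) (𝓝 K) := by
      have : Continuous (fun η : ℝ => K * Real.exp (-η ^ 2 / 2)) := by fun_prop
      have h := this.tendsto 0
      simp only [ne_eq, OfNat.ofNat_ne_zero, not_false_eq_true, zero_pow, neg_zero, zero_div,
        Real.exp_zero, mul_one] at h
      exact h.mono_left nhdsWithin_le_nhds
    have h1 := hc.eventually (lt_mem_nhds (show K - ε < K by linarith))
    obtain ⟨η, h2, h3⟩ := (h1.and self_mem_nhdsWithin).exists
    exact ⟨η, h3, h2⟩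
  have hlim : K * Real.exp (-η ^ 2 / 2) ≤ ((gaussianReal 0 1).real (Set.Ioc (-η) η)) /
      (2 * Real.pi * Real.exp 1) / (2 * η * √(1/2880)) := by
    have h1 := gauss_lower η hη
    have hpi := Real.pi_pos
    have hK2 : K * √(1/2880) * (2 * Real.pi * Real.exp 1) * √(2 * Real.pi) = 1 := by
      have e1 : Real.pi ^ ((3:ℝ)/2) = Real.pi * √Real.pi := by
        rw [show (3:ℝ)/2 = 1 + 1/2 by norm_num, Real.rpow_add hpi, Real.rpow_one,
          Real.sqrt_eq_rpow]
      have e2 : √360 * √(1/2880) * √2 = (1/2 : ℝ) := by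
        rw [← Real.sqrt_mul (by norm_num), ← Real.sqrt_mul (by norm_num),
          show (360 * (1/2880) * 2 : ℝ) = (1/2)^2 by norm_num, Real.sqrt_sq (by norm_num)]
      rw [hK, e1, Real.sqrt_mul (by norm_num)]
      have : √Real.pi ≠ 0 := by positivity
      calc _ = (√360 * √(1/2880) * √2) * 2 := by field_simp
        _ = 1 := by rw [e2]; norm_num
    rw [le_div_iff₀ (by positivity), le_div_iff₀ (by positivity)]
    refine le_trans (le_of_eq ?_) h1
    rw [mul_div_assoc', eq_div_iff (by positivity)]
    calc _ = (K * √(1/2880) * (2 * Real.pi * Real.exp 1) * √(2 * Real.pi)) *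
          (2 * η * Real.exp (-η ^ 2 / 2)) := by ring
      _ = _ := by rw [hK2, one_mul]
  have hev := (constC_tendsto η hη).eventually (lt_mem_nhds (hKη.trans_le hlim))
  obtain ⟨d₀, hd₀⟩ := eventually_atTop.mp hev
  have hDt : Tendsto (fun N : ℕ => √(2 * Real.logb 2 N)) atTop atTop :=
    Real.tendsto_sqrt_atTop.comp ((tendsto_const_nhds.pos_mul_atTop (by norm_num : (0:ℝ) < 2)
      ((Real.tendsto_logb_atTop (by norm_num)).comp tendsto_natCast_atTop_atTop)))
  obtain ⟨N₁, hN₁⟩ := eventually_atTop.mp (hDt.eventually_ge_atTop (d₀ : ℝ))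
  refine ⟨max 2 N₁, fun N hN => ?_⟩
  have hN2 : 2 ≤ N := le_trans (le_max_left _ _) hN
  have h1 := hN₁ N (le_trans (le_max_right _ _) hN)
  have hlog : 0 ≤ 2 * Real.logb 2 N := by
    have : 0 ≤ Real.logb 2 N := Real.logb_nonneg (by norm_num) (by
      have : (2:ℝ) ≤ N := by exact_mod_cast hN2
      linarith)
    linarith
  have h2 := main_ineq η hη N hN2 _ rfl _ rfl
  have h3 : d₀ ≤ ⌈√(2 * Real.logb 2 N)⌉₊ := by
    have := h1.trans (Nat.le_ceil _)
    exact_mod_cast this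
  have h4 := hd₀ _ h3
  refine ge_iff_le.mpr (le_trans ?_ h2)
  have e : (2 * Real.logb 2 N) ^ ((1:ℝ)/4) = √(√(2 * Real.logb 2 N)) := by
    rw [Real.sqrt_eq_rpow, Real.sqrt_eq_rpow, ← Real.rpow_mul hlog]
    norm_num
  rw [e]
  gcongr
end

section
/- Let δ and r be real numbers with 0 ≤ δ ≤ r, and let k, D, d be integers with D ≥ 1, k ≥ 2D + 1, d ≥ 1. Let P(t) = P_0 + P_1 t + ⋯ + P_D t^D be a vector polynomial with coefficients P_0, …, P_D ∈ ℝ^d. If r − δ ≤ ‖P(j)‖₂² ≤ r + δ for every j ∈ {1, …, k}, then ‖P_D‖₂ ≤ 2^D · (2D)!^{−1/2} · √δ. -/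
theorem aux_L (N n : ℕ) : ∑ m ∈ Finset.range (N + 1), ((-1 : ℝ) ^ (N - m) * (N.choose m : ℝ)) * ((m + 1 : ℕ) : ℝ) ^ n
    = (fwdDiff (1 : ℝ))^[N] (fun x : ℝ => x ^ n) 1 := by
  rw [fwdDiff_iter_eq_sum_shift]
  apply Finset.sum_congr rfl
  intro m _
  simp [add_comm]

theorem stmt3 (δ r : ℝ) (hδ : 0 ≤ δ) (hδr : δ ≤ r) (k D d : ℕ)
    (hD : 1 ≤ D) (hk : 2 * D + 1 ≤ k) (hd : 1 ≤ d)
    (P : Fin (D + 1) → EuclideanSpace ℝ (Fin d))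
    (h : ∀ j ∈ Finset.Icc 1 k,
      r - δ ≤ ‖∑ i : Fin (D + 1), ((j : ℝ) ^ (i : ℕ)) • P i‖ ^ 2 ∧
      ‖∑ i : Fin (D + 1), ((j : ℝ) ^ (i : ℕ)) • P i‖ ^ 2 ≤ r + δ) :
    ‖P (Fin.last D)‖ ≤
      2 ^ D * ((2 * D).factorial : ℝ) ^ (-(1 : ℝ) / 2) * Real.sqrt δ := by
  set c : ℕ → ℝ := fun m => (-1 : ℝ) ^ (2 * D - m) * ((2 * D).choose m : ℝ) with hc
  set g : ℕ → ℝ := fun j => ‖∑ i : Fin (D + 1), ((j : ℝ) ^ (i : ℕ)) • P i‖ ^ 2 with hg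
  have L0 : ∀ n, n < 2 * D → ∑ m ∈ Finset.range (2 * D + 1), c m * ((m + 1 : ℕ) : ℝ) ^ n = 0 := by
    intro n hn
    rw [hc, aux_L, fwdDiff_iter_pow_eq_zero_of_lt hn]
    rfl
  have L1 : ∑ m ∈ Finset.range (2 * D + 1), c m * ((m + 1 : ℕ) : ℝ) ^ (2 * D)
      = ((2 * D).factorial : ℝ) := by
    rw [hc, aux_L, fwdDiff_iter_eq_factorial]
    simp
  have gexp : ∀ j : ℕ, g j = ∑ a : Fin (D + 1), ∑ b : Fin (D + 1),
      (j : ℝ) ^ ((a : ℕ) + (b : ℕ)) * inner ℝ (P a) (P b) := by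
    intro j
    simp only [hg]
    rw [← real_inner_self_eq_norm_sq, sum_inner]
    refine Finset.sum_congr rfl fun a _ => ?_
    rw [inner_sum]
    refine Finset.sum_congr rfl fun b _ => ?_
    rw [real_inner_smul_left, real_inner_smul_right, pow_add]
    ring
  have Lg : ∑ m ∈ Finset.range (2 * D + 1), c m * g (m + 1)
      = ((2 * D).factorial : ℝ) * ‖P (Fin.last D)‖ ^ 2 := by
    have e : ∑ m ∈ Finset.range (2 * D + 1), c m * g (m + 1) =
        ∑ a : Fin (D + 1), ∑ b : Fin (D + 1),
          (∑ m ∈ Finset.range (2 * D + 1), c m * ((m + 1 : ℕ) : ℝ) ^ ((a : ℕ) + (b : ℕ)))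
            * inner ℝ (P a) (P b) := by
      simp_rw [gexp, Finset.mul_sum, Finset.sum_mul]
      rw [Finset.sum_comm]
      refine Finset.sum_congr rfl fun a _ => ?_
      rw [Finset.sum_comm]
      refine Finset.sum_congr rfl fun b _ => Finset.sum_congr rfl fun m _ => ?_
      ring
    rw [e, Finset.sum_eq_single (Fin.last D), Finset.sum_eq_single (Fin.last D)]
    · rw [real_inner_self_eq_norm_sq, Fin.val_last, ← two_mul, L1]
    · intro b _ hb
      have : (b : ℕ) < D := Fin.val_lt_last hb
      rw [L0 _ (by simp; omega), zero_mul]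
    · simp
    · intro a _ ha
      have : (a : ℕ) < D := Fin.val_lt_last ha
      refine Finset.sum_eq_zero fun b _ => ?_
      have := b.is_lt
      rw [L0 _ (by omega), zero_mul]
    · simp
  have Lc : ∑ m ∈ Finset.range (2 * D + 1), c m = 0 := by
    simpa using L0 0 (by omega)
  have key : ((2 * D).factorial : ℝ) * ‖P (Fin.last D)‖ ^ 2 ≤ (2 ^ D) ^ 2 * δ := by
    calc _ = ∑ m ∈ Finset.range (2 * D + 1), c m * (g (m + 1) - r) := by
          simp_rw [mul_sub]
          rw [Finset.sum_sub_distrib, ← Finset.sum_mul, Lc, Lg]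
          ring
      _ ≤ ∑ m ∈ Finset.range (2 * D + 1), ((2 * D).choose m : ℝ) * δ := by
          refine Finset.sum_le_sum fun m hm => ?_
          have hm' := Finset.mem_range.1 hm
          have h1 := h (m + 1) (Finset.mem_Icc.2 ⟨by omega, by omega⟩)
          have h2 : |g (m + 1) - r| ≤ δ := by
            rw [abs_le]
            constructor
            · linarith [h1.1]
            · linarith [h1.2]
          refine (le_abs_self _).trans ?_
          rw [abs_mul]
          have h3 : |c m| = ((2 * D).choose m : ℝ) := by
            simp [hc, abs_mul]
          rw [h3]
          gcongr
      _ = (2 ^ D) ^ 2 * δ := by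
          rw [← Finset.sum_mul, ← Nat.cast_sum, Nat.sum_range_choose]
          push_cast
          rw [← pow_mul, mul_comm D 2]
  have fpos : (0 : ℝ) < ((2 * D).factorial : ℝ) := by positivity
  refine (sq_le_sq₀ (norm_nonneg _) (by positivity)).1 ?_
  rw [mul_pow, mul_pow, Real.sq_sqrt hδ, ← Real.rpow_natCast (_ ^ (-(1 : ℝ) / 2)),
    ← Real.rpow_mul fpos.le]
  have : (-(1 : ℝ) / 2) * ((2 : ℕ) : ℝ) = -1 := by norm_num
  rw [this, Real.rpow_neg_one]
  rw [mul_right_comm, ← div_eq_mul_inv, le_div_iff₀ fpos]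
  linarith
end

section
/- Let D ≥ 1 be an integer and δ ≥ 0 a real number. If Q is a real polynomial of degree at most 2D whose coefficient of x^{2D} is q_{2D}, and |Q(j)| ≤ δ for every j ∈ {1, …, 2D + 1}, then |q_{2D}| ≤ (2^{2D}/(2D)!) · δ. -/
theorem stmt4 (D : ℕ) (hD : 1 ≤ D) (δ : ℝ) (hδ : 0 ≤ δ)
    (Q : Polynomial ℝ) (hQ : Q.natDegree ≤ 2 * D)
    (h : ∀ j ∈ Finset.Icc 1 (2 * D + 1), |Q.eval (j : ℝ)| ≤ δ) :
    |Q.coeff (2 * D)| ≤ (2 : ℝ) ^ (2 * D) / ((2 * D).factorial : ℝ) * δ := by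
  generalize 2 * D = n at *
  have key : (fwdDiff (1:ℝ))^[n] (fun x => Q.eval x) 1 = n.factorial * Q.coeff n := by
    have e : (fun x => Q.eval x) =
        ∑ k ∈ Finset.range (n + 1), Q.coeff k • (fun x : ℝ => x ^ k) := by
      funext x
      rw [Polynomial.eval_eq_sum_range' (Nat.lt_succ_of_le hQ)]
      simp
    rw [e, fwdDiff_iter_finsetSum, Finset.sum_range_succ, Finset.sum_eq_zero]
    · rw [fwdDiff_iter_const_smul, fwdDiff_iter_eq_factorial]
      simp [mul_comm]
    · intro k hk
      rw [fwdDiff_iter_const_smul, fwdDiff_iter_pow_eq_zero_of_lt (Finset.mem_range.1 hk),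
        smul_zero]
  have hb : |(n.factorial : ℝ) * Q.coeff n| ≤ 2 ^ n * δ := by
    rw [← key, fwdDiff_iter_eq_sum_shift]
    refine (Finset.abs_sum_le_sum_abs _ _).trans ?_
    have h2 : (2 : ℝ) ^ n = ∑ k ∈ Finset.range (n + 1), (n.choose k : ℝ) := by
      exact_mod_cast (Nat.sum_range_choose n).symm
    rw [h2, Finset.sum_mul]
    refine Finset.sum_le_sum fun k hk => ?_
    have hk' := h (k + 1) (by simp at hk ⊢; omega)
    push_cast at hk'
    rw [add_comm] at hk'
    simp only [zsmul_eq_mul, abs_mul, nsmul_eq_mul, mul_one]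
    push_cast
    rw [abs_mul, abs_pow, abs_neg, abs_one, one_pow, one_mul, Nat.abs_cast]
    gcongr
  have hf : (0 : ℝ) < n.factorial := by positivity
  rw [abs_mul, abs_of_pos hf] at hb
  rw [div_mul_eq_mul_div, le_div_iff₀ hf]
  linarith
end
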